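/- arXiv:2309.17065 — 4 statements merged into one kernel-verified Lean document; each statement's English description precedes it below -/
import Mathlib

section
/- For a positive integer n, the following are equivalent: n is not square-free if and only if there exists a subfield F of the field ℂ of complex numbers (with the subspace topology) such that SL(n,F) is minimal but not totally minimal. -/
/-- A Hausdorff topological group `(G, τ)` is *minimal* if every Hausdorff group topology
on `G` coarser than `τ` equals `τ`.  (In Mathlib's order on `TopologicalSpace G`,
"`σ` is coarser than `τ`" is `τ ≤ σ`.) -/
def IsMinimal (G : Type*) [Group G] [τ : TopologicalSpace G] : Prop :=
  ∀ σ : GroupTopology G, τ ≤ σ.toTopologicalSpace →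
    @T2Space G σ.toTopologicalSpace → σ.toTopologicalSpace = τ

/-- A minimal group `G` is *z-minimal* if `G/Z(G)` (with the quotient topology) is minimal. -/
def IsZMinimal (G : Type*) [Group G] [TopologicalSpace G] : Prop :=
  IsMinimal G ∧ IsMinimal (G ⧸ Subgroup.center G)

/-- A topological group is *totally minimal* if all of its Hausdorff quotients, i.e. the
quotients by closed normal subgroups, are minimal. -/
def IsTotallyMinimal (G : Type*) [Group G] [TopologicalSpace G] : Prop :=
  ∀ (N : Subgroup G) [N.Normal], IsClosed (N : Set G) → IsMinimal (G ⧸ N)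

/-- `SL(n,F)` carries the pointwise topology inherited from `F^(n²)`. -/
instance {m : Type*} [DecidableEq m] [Fintype m] {R : Type*} [CommRing R]
    [TopologicalSpace R] : TopologicalSpace (Matrix.SpecialLinearGroup m R) :=
  inferInstanceAs (TopologicalSpace { A : Matrix m m R // A.det = 1 })

section

open Matrix Topology Filter

namespace Matrix.SpecialLinearGroup

section Algebra

variable {ι F : Type*} [Fintype ι] [DecidableEq ι] [Field F]

lemma diag2n_eq_prod_transvection {i j : ι} (hij : i ≠ j) {a : F} (ha : a ≠ 0) :
    diag2n hij a ha = transvection hij a * transvection hij.symm (-a⁻¹) * transvection hij a *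
      (transvection hij (-1) * transvection hij.symm 1 * transvection hij (-1)) := by
  have h : (diag2n hij a ha : Matrix ι ι F) =
      1 + single i i (a - 1) + single j j (a⁻¹ - 1) := by
    ext p q
    rw [diag2n_coe]
    simp only [diagonal_apply, add_apply, one_apply, single_apply]
    grind
  apply Subtype.ext
  rw [h]
  simp only [coe_mul, transvection_coe, mul_add, add_mul, one_mul, mul_one,
    single_mul_single_same, single_mul_single_of_ne _ _ _ _ hij,
    single_mul_single_of_ne _ _ _ _ hij.symm, add_zero]
  ext p q
  simp only [add_apply, one_apply, single_apply]
  grind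

lemma transvection_induction [Nontrivial ι] (P : SpecialLinearGroup ι F → Prop)
    (htransvec : ∀ (i j : ι) (h : i ≠ j) (c : F), P (transvection h c))
    (hmul : ∀ A B, P A → P B → P (A * B)) (A : SpecialLinearGroup ι F) : P A := by
  refine diagonal_transvection_induction' P A (fun i j hij c hc ↦ ?_) htransvec hmul
  rw [diag2n_eq_prod_transvection]
  exact hmul _ _ (hmul _ _ (hmul _ _ (htransvec ..) (htransvec ..)) (htransvec ..))
    (hmul _ _ (hmul _ _ (htransvec ..) (htransvec ..)) (htransvec ..))

open scoped commutatorElement in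
lemma commutator_diag2n_transvection {i j : ι} (hij : i ≠ j) {a : F} (ha : a ≠ 0) (b : F) :
    ⁅diag2n hij a ha, transvection hij b⁆ = transvection hij (b * (a ^ 2 - 1)) := by
  rw [commutatorElement_def, mul_inv_eq_iff_eq_mul, mul_inv_eq_iff_eq_mul, ← transvection_add]
  apply Subtype.ext
  ext p q
  simp only [coe_mul, diag2n_coe, transvection_coe, diagonal_mul, mul_diagonal,
    add_apply, one_apply, single_apply]
  grind

lemma commutator_eq_top [Nontrivial ι] [Infinite F] :
    commutator (SpecialLinearGroup ι F) = ⊤ := by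
  classical
  obtain ⟨a, ha⟩ := Infinite.exists_notMem_finset ({0, 1, -1} : Finset F)
  simp only [Finset.mem_insert, Finset.mem_singleton, not_or] at ha
  have h : a ^ 2 - 1 ≠ 0 := by grind
  refine le_antisymm le_top fun A _ ↦
    transvection_induction _ (fun i j hij c ↦ ?_) (fun _ _ ↦ mul_mem) A
  rw [← div_mul_cancel₀ c h, ← commutator_diag2n_transvection hij ha.1]
  exact Subgroup.commutator_mem_commutator (Subgroup.mem_top _) (Subgroup.mem_top _)

open scoped LinearAlgebra.Projectivization

/-- The Iwasawa structure of `SL(ι, F)` acting on the projective space. -/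
noncomputable def iwasawaStructure (ι F : Type*) [Fintype ι] [DecidableEq ι] [Field F]
    [Nontrivial ι] :
    MulAction.IwasawaStructure (SpecialLinearGroup ι F) (ℙ F (ι → F)) where
  T p := lineStab p.submodule
  is_comm p := by
    rw [← Projectivization.mk_rep p, Projectivization.submodule_mk]
    exact lineStab_isMulCommutative_of_span p.rep p.rep_nonzero
  is_conj g p := by rw [PSL.smul_submodule, lineStab_smul]
  is_generator := by
    refine le_antisymm le_top fun A _ ↦
      transvection_induction _ (fun i j hij c ↦ ?_) (fun _ _ ↦ mul_mem) A
    refine Subgroup.mem_iSup_of_mem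
      (Projectivization.mk F (Pi.single i 1 : ι → F) (Pi.single_ne_zero_iff.2 one_ne_zero)) ?_
    rw [Projectivization.submodule_mk]
    exact SL2Gen.transvection_mem_lineStab hij c

/-- A normal subgroup of `SL(ι, F)`, for `F` infinite, is central or everything. -/
theorem normal_le_center_or_eq_top [Nontrivial ι] [Infinite F]
    (N : Subgroup (SpecialLinearGroup ι F)) [N.Normal] :
    N ≤ Subgroup.center _ ∨ N = ⊤ := by
  by_cases h : MulAction.fixedPoints N (ℙ F (ι → F)) = .univ
  · left
    intro g hg
    rw [← Projectivization.SL_mulAction_ker, MonoidHom.mem_ker]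
    ext1 x
    exact Set.eq_univ_iff_forall.1 h x ⟨g, hg⟩
  · right
    rw [eq_top_iff, ← commutator_eq_top]
    exact (iwasawaStructure ι F).commutator_le N h

end Algebra
end Matrix.SpecialLinearGroup

section ClusterSubgroup

variable {G H S : Type*} [Group G] [Group H] [TopologicalSpace H] [IsTopologicalGroup H]
  [Group S] [TopologicalSpace S] [IsTopologicalGroup S]

/-- The set of limits in `H` of nets `φ (g i)` with `f (g i)` tending to `1`. -/
def clusterSubgroup (φ : G →* H) (f : G →* S) : Subgroup H where
  carrier := {c | ∀ V ∈ 𝓝 (1 : S), c ∈ closure (φ '' (f ⁻¹' V))}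
  one_mem' V hV := subset_closure ⟨1, by simpa using mem_of_mem_nhds hV, map_one φ⟩
  mul_mem' {c d} hc hd V hV := by
    obtain ⟨U, hU, hUV⟩ := exists_nhds_one_split hV
    refine map_mem_closure₂ continuous_mul (hc U hU) (hd U hU) ?_
    rintro _ ⟨x, hx, rfl⟩ _ ⟨y, hy, rfl⟩
    exact ⟨x * y, by simpa using hUV _ hx _ hy, map_mul φ x y⟩
  inv_mem' {c} hc V hV := by
    refine map_mem_closure continuous_inv (hc _ (inv_mem_nhds_one S hV)) ?_
    rintro _ ⟨x, hx, rfl⟩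
    exact ⟨x⁻¹, by simpa using hx, map_inv φ x⟩

variable {φ : G →* H} {f : G →* S}

lemma mem_clusterSubgroup {c : H} :
    c ∈ clusterSubgroup φ f ↔ ∀ V ∈ 𝓝 (1 : S), c ∈ closure (φ '' (f ⁻¹' V)) := Iff.rfl

lemma isClosed_clusterSubgroup : IsClosed (clusterSubgroup φ f : Set H) := by
  have : (clusterSubgroup φ f : Set H) = ⋂ V ∈ 𝓝 (1 : S), closure (φ '' (f ⁻¹' V)) := by
    ext c
    simp [mem_clusterSubgroup]
  rw [this]
  exact isClosed_biInter fun _ _ ↦ isClosed_closure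

lemma clusterSubgroup_normal (hφ : DenseRange φ) : (clusterSubgroup φ f).Normal where
  conj_mem c hc h := by
    refine hφ.induction_on (p := fun h ↦ h * c * h⁻¹ ∈ clusterSubgroup φ f) h
      (isClosed_clusterSubgroup.preimage (by fun_prop)) fun g V hV ↦ ?_
    have hV' : (fun s ↦ f g * s * (f g)⁻¹) ⁻¹' V ∈ 𝓝 (1 : S) :=
      ContinuousAt.preimage_mem_nhds (by fun_prop) (by simpa using hV)
    refine map_mem_closure (f := fun x ↦ φ g * x * (φ g)⁻¹) (by fun_prop) (hc _ hV') ?_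
    rintro _ ⟨x, hx, rfl⟩
    exact ⟨g * x * g⁻¹, by simpa using hx, by simp⟩

lemma comap_clusterSubgroup [TopologicalSpace G] [T2Space S] (hφ : IsInducing φ)
    (hf : Continuous f) : (clusterSubgroup φ f).comap φ = f.ker := by
  ext g
  rw [Subgroup.mem_comap, mem_clusterSubgroup, MonoidHom.mem_ker]
  refine ⟨fun h ↦ ?_, fun h V hV ↦
    subset_closure ⟨g, by simpa [h] using mem_of_mem_nhds hV, rfl⟩⟩
  by_contra hne
  obtain ⟨U, V, hU, hV, hgU, h1V, hUV⟩ := t2_separation hne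
  have hg := h V (hV.mem_nhds h1V)
  rw [← Set.mem_preimage, ← hφ.closure_eq_preimage_closure_image] at hg
  obtain ⟨x, hxU, hxV⟩ := mem_closure_iff.1 hg _ (hU.preimage hf) hgU
  exact Set.disjoint_left.1 hUV hxU hxV

lemma exists_nhds_disjoint_of_isCompact {T : Set H} (hT : IsCompact T)
    (hdisj : Disjoint T (clusterSubgroup φ f)) :
    ∃ V ∈ 𝓝 (1 : S), ∀ g, f g ∈ V → φ g ∉ T := by
  have hL : Tᶜ ∈ map φ (comap f (𝓝 1)) := by
    by_contra hL
    have : (map φ (comap f (𝓝 1)) ⊓ 𝓟 T).NeBot := by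
      simpa [← mem_iff_inf_principal_compl, neBot_iff] using
        (mem_iff_inf_principal_compl (f := map φ (comap f (𝓝 1))) (s := Tᶜ)).not.1 hL
    obtain ⟨x, hxT, hx⟩ := hT (f := map φ (comap f (𝓝 1)) ⊓ 𝓟 T) inf_le_right
    refine Set.disjoint_left.1 hdisj hxT fun V hV ↦ ?_
    exact clusterPt_iff_forall_mem_closure.1 (hx.mono inf_le_left) _
      (image_mem_map (preimage_mem_comap hV))
  obtain ⟨V, hV, h⟩ := hL
  exact ⟨V, hV, fun g hg ↦ h hg⟩

lemma mem_comap_nhds_one_of_isCompact [TopologicalSpace G] [T2Space S] (hφ : IsInducing φ)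
    (hf : Continuous f) (hrange : clusterSubgroup φ f ≤ φ.range) {V₀ : Set S}
    (hV₀ : V₀ ∈ 𝓝 1) {T : Set H} (hT : IsCompact T) (hVT : ∀ g, f g ∈ V₀ → φ g ∈ T)
    {W : Set G} (hW : IsOpen W) (hker : (f.ker : Set G) ⊆ W) : W ∈ comap f (𝓝 1) := by
  obtain ⟨O, hO, rfl⟩ := hφ.isOpen_iff.1 hW
  obtain ⟨V, hV, h⟩ := exists_nhds_disjoint_of_isCompact (φ := φ) (f := f) (hT.diff hO) <| by
    refine Set.disjoint_left.2 fun c hc hc' ↦ hc.2 ?_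
    obtain ⟨g, rfl⟩ := hrange hc'
    refine hker ?_
    rwa [SetLike.mem_coe, ← comap_clusterSubgroup hφ hf]
  refine ⟨V ∩ V₀, inter_mem hV hV₀, fun g hg ↦ ?_⟩
  by_contra hgO
  exact h g hg.1 ⟨hVT g hg.2, hgO⟩

/-- If the image in `H` of a minimal quotient of `G` by `M ∩ G` is dense, then the finite central
subgroup `M` is contained in the image of `G`. -/
lemma IsMinimal.le_range [TopologicalSpace G] [IsTopologicalGroup G] [T2Space H]
    {Q : Type*} [Group Q] [TopologicalSpace Q] (hQ : IsMinimal Q) {q : G →* Q}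
    (hq : IsOpenQuotientMap q) (hφ : IsInducing φ) (hd : DenseRange φ) {M : Subgroup H} [Finite M]
    (hM : M ≤ Subgroup.center H) (hker : M.comap φ = q.ker) : M ≤ φ.range := by
  intro m hm
  by_contra hmr
  have hMn : M.Normal := ⟨fun n hn g ↦ by
    rwa [Subgroup.mem_center_iff.1 (hM hn) g, mul_inv_cancel_right]⟩
  have hMc : IsClosed (M : Set H) := (Set.toFinite _).isClosed
  let ψ : Q →* H ⧸ M := q.liftOfSurjective hq.surjective ⟨(QuotientGroup.mk' M).comp φ, by
    rw [← hker, ← MonoidHom.comap_ker, QuotientGroup.ker_mk']⟩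
  have hψ (g : G) : ψ (q g) = QuotientGroup.mk (φ g) :=
    q.liftOfRightInverse_comp_apply _ (Function.rightInverse_surjInv hq.surjective) _ g
  have hψi : Function.Injective ψ := by
    rw [injective_iff_map_eq_one]
    intro x hx
    obtain ⟨g, rfl⟩ := hq.surjective x
    rw [hψ, QuotientGroup.eq_one_iff] at hx
    rwa [← MonoidHom.mem_ker, ← hker]
  let σ : GroupTopology Q :=
    { toTopologicalSpace := .induced ψ inferInstance
      toIsTopologicalGroup := topologicalGroup_induced ψ }
  have hσ : σ.toTopologicalSpace = ‹TopologicalSpace Q› := by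
    refine hQ σ ?_ ?_
    · change _ ≤ TopologicalSpace.induced ψ _
      rw [← continuous_iff_le_induced, hq.isQuotientMap.continuous_iff]
      have : ⇑ψ ∘ q = QuotientGroup.mk ∘ φ := funext hψ
      rw [this]
      exact continuous_quot_mk.comp hφ.continuous
    · let := σ.toTopologicalSpace
      exact T2Space.of_injective_continuous hψi continuous_induced_dom
  have hψind : IsInducing ψ := ⟨hσ.symm⟩
  have : (comap φ (𝓝 m)).NeBot := comap_neBot fun t ht ↦ by
    simpa using hd.exists_mem_open isOpen_interior ⟨m, mem_interior_iff_mem_nhds.2 ht⟩ |>.imp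
      fun _ h ↦ interior_subset h
  have hlim : Tendsto q (comap φ (𝓝 m)) (𝓝 1) := by
    rw [hψind.tendsto_nhds_iff, map_one]
    have : ⇑ψ ∘ q = QuotientGroup.mk ∘ φ := funext hψ
    rw [this, ← (QuotientGroup.eq_one_iff m).2 hm]
    exact (QuotientGroup.continuous_mk.tendsto m).comp tendsto_comap
  let M' : Subgroup H := M ⊓ φ.range
  have hX : ((fun x ↦ m⁻¹ * x) ⁻¹' (M' : Set H))ᶜ ∈ 𝓝 (1 : H) := by
    refine IsOpen.mem_nhds ?_ ?_
    · have : IsClosed (M' : Set H) :=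
        ((Set.toFinite (M : Set H)).subset inf_le_left).isClosed
      exact (this.preimage (continuous_const_mul _)).isOpen_compl
    · intro h
      have := h.2
      simp only [mul_one] at this
      exact hmr (inv_mem_iff.1 this)
  obtain ⟨U, hU, hU1, hUX⟩ : ∃ U : Set H, IsOpen U ∧ 1 ∈ U ∧ ∀ u ∈ U, ∀ v ∈ U,
      u⁻¹ * v ∈ ((fun x ↦ m⁻¹ * x) ⁻¹' (M' : Set H))ᶜ := by
    have : Tendsto (fun p : H × H ↦ p.1⁻¹ * p.2) (𝓝 (1, 1)) (𝓝 1) := by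
      have h : Continuous (fun p : H × H ↦ p.1⁻¹ * p.2) := by fun_prop
      simpa using h.tendsto (1, 1)
    obtain ⟨U, V, hU, hU1, hV, hV1, h⟩ := mem_nhds_prod_iff'.1 (this hX)
    exact ⟨U ∩ V, hU.inter hV, ⟨hU1, hV1⟩, fun u hu v hv ↦ h (a := (u, v)) ⟨hu.1, hv.2⟩⟩
  have h1 : q '' (φ ⁻¹' U) ∈ 𝓝 (1 : Q) :=
    (hq.isOpenMap _ (hU.preimage hφ.continuous)).mem_nhds ⟨1, by simpa using hU1, map_one q⟩
  have h2 : (fun x ↦ x * m⁻¹) ⁻¹' U ∈ 𝓝 m :=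
    ContinuousAt.preimage_mem_nhds (by fun_prop) (by simpa using hU.mem_nhds hU1)
  obtain ⟨g, ⟨g', hg', hgg'⟩, hg⟩ := ((hlim h1 : _ ∈ comap φ (𝓝 m)) |> fun h ↦
    Filter.nonempty_of_mem (inter_mem h (preimage_mem_comap h2)))
  have hk : g⁻¹ * g' ∈ M.comap φ := by
    rw [hker, MonoidHom.mem_ker]
    simp [hgg']
  refine hUX _ hg _ hg' ?_
  have : m⁻¹ * ((φ g * m⁻¹)⁻¹ * φ g') = φ (g⁻¹ * g') := by simp [mul_assoc]
  change m⁻¹ * ((φ g * m⁻¹)⁻¹ * φ g') ∈ M'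
  rw [this]
  exact ⟨hk, ⟨_, rfl⟩⟩

end ClusterSubgroup

namespace Matrix.SpecialLinearGroup

section Topology

variable {ι R S : Type*} [Fintype ι] [DecidableEq ι] [CommRing R] [CommRing S]
  [TopologicalSpace R] [TopologicalSpace S]

lemma isEmbedding_coe : IsEmbedding (fun g : SpecialLinearGroup ι R ↦ (g : Matrix ι ι R)) :=
  .subtypeVal

lemma isClosedEmbedding_coe [IsTopologicalRing R] [T1Space R] :
    IsClosedEmbedding (fun g : SpecialLinearGroup ι R ↦ (g : Matrix ι ι R)) :=
  (isClosed_singleton.preimage continuous_id.matrix_det).isClosedEmbedding_subtypeVal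

instance isTopologicalGroup [IsTopologicalRing R] :
    IsTopologicalGroup (SpecialLinearGroup ι R) where
  continuous_inv := continuous_induced_rng.mpr continuous_induced_dom.matrix_adjugate
  continuous_mul := continuous_induced_rng.mpr <|
    (continuous_induced_dom.comp continuous_fst).mul (continuous_induced_dom.comp continuous_snd)

instance t2Space [T2Space R] : T2Space (SpecialLinearGroup ι R) := isEmbedding_coe.t2Space

lemma continuous_entry (i j : ι) : Continuous fun g : SpecialLinearGroup ι R ↦ g i j :=
  isEmbedding_coe.continuous.matrix_elem i j

lemma isInducing_map {j : R →+* S} (hj : IsInducing j) :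
    IsInducing (map (n := ι) j) :=
  (hj.matrix_map.comp .subtypeVal).of_comp
    (continuous_induced_rng.mpr (isEmbedding_coe.continuous.matrix_map hj.continuous))
    continuous_subtype_val

lemma continuous_transvection [IsTopologicalRing R] {i j : ι} (hij : i ≠ j) :
    Continuous fun c : R ↦ transvection hij c := by
  refine continuous_induced_rng.mpr ?_
  change Continuous fun c : R ↦ (transvection hij c : Matrix ι ι R)
  refine continuous_matrix fun a b ↦ ?_
  simp only [transvection_coe, add_apply, single_apply]
  split_ifs <;> fun_prop

end Topology

section Field

variable {ι F K : Type*} [Fintype ι] [DecidableEq ι] [Field F]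

lemma map_transvection [Field K] (j : F →+* K) {p q : ι} (h : p ≠ q) (c : F) :
    map j (transvection h c) = transvection h (j c) := by
  ext a b
  simp [transvection_coe, single_apply, one_apply, apply_ite j]

lemma denseRange_map [Nontrivial ι] [Field K] [TopologicalSpace K] [IsTopologicalRing K] {j : F →+* K}
    (hj : DenseRange j) : DenseRange (map (n := ι) j) := by
  intro A
  change A ∈ (map (n := ι) j).range.topologicalClosure
  refine transvection_induction _ (fun p q h c ↦ ?_) (fun _ _ ↦ mul_mem) A
  refine map_mem_closure (continuous_transvection h) (hj c) ?_
  rintro _ ⟨x, rfl⟩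
  exact ⟨_, map_transvection j h x⟩

lemma exists_le_norm_entry (ι K : Type*) [Fintype ι] [DecidableEq ι] [Nonempty ι] [NormedField K] :
    ∃ c > 0, ∀ g : SpecialLinearGroup ι K, ∃ i j, c ≤ ‖g i j‖ := by
  refine ⟨((Fintype.card ι).factorial + 1 : ℝ)⁻¹, by positivity, fun g ↦ ?_⟩
  by_contra! h
  have := det_le (abv := NormedField.toAbsoluteValue K) (fun i j ↦ (h i j).le)
  rw [g.det_coe, map_one, nsmul_eq_mul] at this
  set N : ℝ := ((Fintype.card ι).factorial : ℝ)
  have hN : 0 ≤ N := by positivity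
  have hc : (N + 1)⁻¹ ^ Fintype.card ι ≤ (N + 1)⁻¹ :=
    pow_le_of_le_one (by positivity) (inv_le_one_of_one_le₀ (by linarith)) Fintype.card_ne_zero
  have : N * (N + 1)⁻¹ < 1 := by rw [← div_eq_mul_inv, div_lt_one (by positivity)]; linarith
  nlinarith

lemma exists_norm_entry_le (ι K : Type*) [Fintype ι] [DecidableEq ι] [Nontrivial ι] [NormedField K]
    (B : ℝ) : ∃ R, ∀ g : SpecialLinearGroup ι K,
      (∀ i j, i ≠ j → ∀ a b, ‖g a j‖ * ‖g⁻¹ i b‖ ≤ B) → ∀ a b, ‖g a b‖ ≤ R := by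
  obtain ⟨c, hc, hle⟩ := exists_le_norm_entry ι K
  have hn : (0 : ℝ) < Fintype.card ι := by exact_mod_cast Fintype.card_pos
  refine ⟨max (B / c) (Fintype.card ι * (B / c * B)), fun g hg a b ↦ ?_⟩
  obtain ⟨i₀, b₀, h₀⟩ := hle g⁻¹
  have hcol (j) (hj : j ≠ i₀) (a) : ‖g a j‖ ≤ B / c := by
    rw [le_div_iff₀ hc]
    exact (mul_le_mul_of_nonneg_left h₀ (norm_nonneg _)).trans (hg i₀ j hj.symm a b₀)
  obtain rfl | hb := eq_or_ne b i₀
  · refine le_max_of_le_right ?_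
    obtain ⟨i, hi⟩ := exists_ne b
    obtain ⟨p, hp⟩ : ∃ p, (Fintype.card ι : ℝ)⁻¹ ≤ ‖g⁻¹ i p‖ * ‖g p i‖ := by
      by_contra! h
      have hsum : ∑ p, g⁻¹ i p * g p i = 1 := by
        have : ((g⁻¹ * g : SpecialLinearGroup ι K) : Matrix ι ι K) i i = 1 := by simp
        rwa [coe_mul, mul_apply] at this
      have : ‖∑ p, g⁻¹ i p * g p i‖ < ∑ p : ι, (Fintype.card ι : ℝ)⁻¹ :=
        (norm_sum_le _ _).trans_lt <|
          Finset.sum_lt_sum_of_nonempty Finset.univ_nonempty fun p _ ↦ by simpa using h p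
      rw [hsum, Finset.sum_const, Finset.card_univ, nsmul_eq_mul, mul_inv_cancel₀ hn.ne'] at this
      simp at this
    have h1 := hg i b hi a p
    have h2 := hcol i hi p
    have h3 : 1 ≤ Fintype.card ι * (‖g⁻¹ i p‖ * ‖g p i‖) := by
      rwa [inv_le_iff_one_le_mul₀' hn] at hp
    calc ‖g a b‖ ≤ ‖g a b‖ * (Fintype.card ι * (‖g⁻¹ i p‖ * ‖g p i‖)) :=
          le_mul_of_one_le_right (norm_nonneg _) h3
      _ = Fintype.card ι * (‖g p i‖ * (‖g a b‖ * ‖g⁻¹ i p‖)) := by ring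
      _ ≤ _ := by
        have := (norm_nonneg _).trans h2
        gcongr
  · exact le_max_of_le_left (hcol b hb a)

lemma isCompact_setOf_norm_entry_le (ι K : Type*) [Fintype ι] [DecidableEq ι] [NormedField K]
    [ProperSpace K] (R : ℝ) : IsCompact {g : SpecialLinearGroup ι K | ∀ a b, ‖g a b‖ ≤ R} := by
  have : IsCompact (Set.univ.pi fun _ : ι ↦ Set.univ.pi fun _ : ι ↦ Metric.closedBall (0 : K) R) :=
    isCompact_univ_pi fun _ ↦ isCompact_univ_pi fun _ ↦ isCompact_closedBall _ _
  convert (isClosedEmbedding_coe (ι := ι) (R := K)).isCompact_preimage this using 1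
  ext g
  exact ⟨fun h a _ b _ ↦ by simpa using h a b, fun h a b ↦ by simpa using h a trivial b trivial⟩

end Field

section NonEscape

variable {ι F K : Type*} [Fintype ι] [DecidableEq ι]

lemma coe_conj_transvection_sub_one [Field K] (g : SpecialLinearGroup ι K) {p q : ι} (h : p ≠ q)
    (s : K) : ((g * transvection h s * g⁻¹ : SpecialLinearGroup ι K) : Matrix ι ι K) - 1 =
      g * single p q s * (g⁻¹ : SpecialLinearGroup ι K) := by
  have : (g : Matrix ι ι K) * (g⁻¹ : SpecialLinearGroup ι K) = 1 := by
    rw [← coe_mul, mul_inv_cancel, coe_one]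
  rw [coe_mul, coe_mul, transvection_coe, mul_add, add_mul, mul_one, this, add_sub_cancel_left]

lemma coe_conj_transvection_sub_one_apply [Field K] (g : SpecialLinearGroup ι K) {p q : ι}
    (h : p ≠ q) (s : K) (a b : ι) :
    (((g * transvection h s * g⁻¹ : SpecialLinearGroup ι K) : Matrix ι ι K) - 1) a b =
      s * (g a p * g⁻¹ q b) := by
  rw [coe_conj_transvection_sub_one, mul_apply, Finset.sum_eq_single q]
  · rw [mul_single_apply_same]
    ring
  · intro r _ hr
    rw [mul_single_apply_of_ne _ _ _ _ _ hr, zero_mul]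
  · simp

lemma coe_conj_transvection_sub_one_mul_self [Field K] (g : SpecialLinearGroup ι K) {p q : ι}
    (h : p ≠ q) (s : K) :
    (((g * transvection h s * g⁻¹ : SpecialLinearGroup ι K) : Matrix ι ι K) - 1) *
      (((g * transvection h s * g⁻¹ : SpecialLinearGroup ι K) : Matrix ι ι K) - 1) = 0 := by
  have : ((g⁻¹ : SpecialLinearGroup ι K) : Matrix ι ι K) * g = 1 := by
    rw [← coe_mul, inv_mul_cancel, coe_one]
  rw [coe_conj_transvection_sub_one,
    show ∀ A E B : Matrix ι ι K, A * E * B * (A * E * B) = A * (E * (B * A) * E) * B by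
      intros; noncomm_ring, this, mul_one, single_mul_single_of_ne _ _ _ _ h.symm, mul_zero,
    zero_mul]

/-- Bounded unipotent elements `h` with `(h - 1) ^ 2 = 0`, at distance at least `δ` from `1`. -/
def unipotentShell (ι K : Type*) [Fintype ι] [DecidableEq ι] [NormedField K] (δ : ℝ) :
    Set (SpecialLinearGroup ι K) :=
  {h | (∀ a b, ‖((h : Matrix ι ι K) - 1) a b‖ ≤ 1) ∧ (∃ a b, δ ≤ ‖((h : Matrix ι ι K) - 1) a b‖) ∧
    ((h : Matrix ι ι K) - 1) * ((h : Matrix ι ι K) - 1) = 0}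

lemma isCompact_unipotentShell [NormedField K] [ProperSpace K] (δ : ℝ) :
    IsCompact (unipotentShell ι K δ) := by
  have hc : Continuous fun h : SpecialLinearGroup ι K ↦ (h : Matrix ι ι K) - 1 :=
    isEmbedding_coe.continuous.sub continuous_const
  have he (a b : ι) := (hc.matrix_elem a b).norm
  refine (isCompact_setOf_norm_entry_le ι K 2).of_isClosed_subset ?_ fun h hh a b ↦ ?_
  · have : unipotentShell ι K δ =
        (⋂ a, ⋂ b, {h : SpecialLinearGroup ι K | ‖((h : Matrix ι ι K) - 1) a b‖ ≤ 1}) ∩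
          ((⋃ a, ⋃ b, {h : SpecialLinearGroup ι K | δ ≤ ‖((h : Matrix ι ι K) - 1) a b‖}) ∩
            {h : SpecialLinearGroup ι K | ((h : Matrix ι ι K) - 1) * ((h : Matrix ι ι K) - 1) = 0}) := by
      ext h
      simp [unipotentShell]
    rw [this]
    refine IsClosed.inter ?_ (IsClosed.inter ?_ ?_)
    · exact isClosed_iInter fun a ↦ isClosed_iInter fun b ↦ isClosed_le (he a b) continuous_const
    · exact isClosed_iUnion_of_finite fun a ↦ isClosed_iUnion_of_finite fun b ↦
        isClosed_le continuous_const (he a b)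
    · exact isClosed_eq (hc.mul hc) continuous_const
  · have h1 := hh.1 a b
    have h2 : ‖(1 : Matrix ι ι K) a b‖ ≤ 1 := by
      rw [one_apply]
      split_ifs <;> simp
    calc ‖h a b‖ = ‖((h : Matrix ι ι K) - 1) a b + (1 : Matrix ι ι K) a b‖ := by simp
      _ ≤ 1 + 1 := (norm_add_le _ _).trans (add_le_add h1 h2)
      _ = 2 := by norm_num

lemma disjoint_unipotentShell_center [NormedField K] {δ : ℝ} (hδ : 0 < δ) :
    Disjoint (unipotentShell ι K δ) (Subgroup.center (SpecialLinearGroup ι K)) := by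
  refine Set.disjoint_left.2 fun h ⟨_, ⟨a, b, hab⟩, h0⟩ hc ↦ ?_
  obtain ⟨r, -, hr⟩ := mem_center_iff.1 hc
  have h1 : (h : Matrix ι ι K) - 1 = scalar ι (r - 1) := by rw [map_sub, map_one, hr]
  rw [h1] at hab h0
  rw [← map_mul] at h0
  have := congr_fun₂ h0 a a
  simp only [scalar_apply, diagonal_apply_eq, zero_apply, mul_self_eq_zero] at this
  rw [this] at hab
  simp at hab
  linarith

variable [Field F] [TopologicalSpace F] [IsTopologicalRing F] [NontriviallyNormedField K]
  [ProperSpace K]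

lemma exists_norm_entry_le_of_clusterSubgroup_le_center [Nontrivial ι] {j : F →+* K}
    (hj : IsInducing j) (hd : DenseRange j) {S : Type*} [Group S] [TopologicalSpace S]
    [IsTopologicalGroup S] {f : SpecialLinearGroup ι F →* S} (hf : Continuous f)
    (hC : clusterSubgroup (map j) f ≤ Subgroup.center _) :
    ∃ V ∈ 𝓝 (1 : S), ∃ R, ∀ g, f g ∈ V → ∀ a b, ‖map j g a b‖ ≤ R := by
  obtain ⟨c, hc⟩ : ∃ c, 1 < ‖j c‖ :=
    hd.exists_mem_open (isOpen_lt continuous_const continuous_norm)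
      (NormedField.exists_one_lt_norm K)
  have hδ : 0 < 1 / ‖j c‖ := by positivity
  obtain ⟨V, hV, hVT⟩ := exists_nhds_disjoint_of_isCompact (isCompact_unipotentShell (1 / ‖j c‖))
    ((disjoint_unipotentShell_center hδ).mono_right hC)
  obtain ⟨V', hV', hconj⟩ : ∃ V' ∈ 𝓝 (1 : S), ∀ v ∈ V', ∀ x ∈ V', v * x * v⁻¹ ∈ V := by
    have : Tendsto (fun p : S × S ↦ p.1 * p.2 * p.1⁻¹) (𝓝 1 ×ˢ 𝓝 1) (𝓝 1) := by
      have h : Continuous (fun p : S × S ↦ p.1 * p.2 * p.1⁻¹) := by fun_prop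
      simpa [nhds_prod_eq] using h.tendsto (1, 1)
    obtain ⟨U, hU, h⟩ := mem_prod_self_iff.1 (this hV)
    exact ⟨U, hU, fun v hv x hx ↦ h (a := (v, x)) ⟨hv, hx⟩⟩
  obtain ⟨ε, hε, htr⟩ : ∃ ε > 0, ∀ s, ‖j s‖ < ε → ∀ p q : ι, ∀ h : p ≠ q,
      f (transvection h s) ∈ V' := by
    have : ∀ᶠ s in 𝓝 (0 : F), ∀ x : {x : ι × ι // x.1 ≠ x.2}, f (transvection x.2 s) ∈ V' := by
      refine eventually_all.2 fun x ↦ ?_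
      refine (hf.comp (continuous_transvection x.2)).continuousAt.eventually_mem ?_
      simpa using hV'
    rw [hj.nhds_eq_comap, map_zero, (Metric.nhds_basis_ball.comap j).eventually_iff] at this
    obtain ⟨ε, hε, h⟩ := this
    exact ⟨ε, hε, fun s hs p q hpq ↦ h (by simpa using hs) ⟨(p, q), hpq⟩⟩
  obtain ⟨R, hR⟩ := exists_norm_entry_le ι K ε⁻¹
  refine ⟨V', hV', R, fun g hg ↦ hR _ fun q p hqp ↦ ?_⟩
  by_contra! hlt
  set G := map j g with hG
  obtain ⟨⟨a, b⟩, hmax⟩ := Finite.exists_max fun x : ι × ι ↦ ‖G x.1 p * G⁻¹ q x.2‖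
  obtain ⟨a', b', hab⟩ := hlt
  have hL : ε⁻¹ < ‖G a p * G⁻¹ q b‖ := by
    rw [← norm_mul] at hab
    exact hab.trans_le (hmax (a', b'))
  have hL0 : 0 < ‖G a p * G⁻¹ q b‖ := (inv_pos.2 hε).trans hL
  obtain ⟨n, -, hn1, hn2, -⟩ := rescale_to_shell_zpow hc one_pos (norm_pos_iff.1 hL0)
  rw [← map_zpow₀, smul_eq_mul] at hn1 hn2
  have hs : ‖j (c ^ n)‖ < ε := by
    rw [norm_mul] at hn1
    rw [inv_lt_iff_one_lt_mul₀ hε] at hL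
    by_contra! h
    nlinarith
  refine hVT (g * transvection hqp.symm (c ^ n) * g⁻¹) ?_ ?_
  · simpa using hconj _ hg _ (htr _ hs _ _ hqp.symm)
  · rw [map_mul, map_mul, map_inv, map_transvection, ← hG]
    refine ⟨fun x y ↦ ?_, ⟨a, b, ?_⟩, coe_conj_transvection_sub_one_mul_self _ _ _⟩
    · rw [coe_conj_transvection_sub_one_apply]
      refine le_trans ?_ hn1.le
      rw [norm_mul, norm_mul (j (c ^ n))]
      exact mul_le_mul_of_nonneg_left (hmax (x, y)) (norm_nonneg (j (c ^ n)))
    · rwa [coe_conj_transvection_sub_one_apply]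

lemma mem_comap_nhds_one [Nontrivial ι] {j : F →+* K} (hj : IsInducing j) (hd : DenseRange j)
    {S : Type*} [Group S] [TopologicalSpace S] [IsTopologicalGroup S] [T2Space S]
    {f : SpecialLinearGroup ι F →* S} (hf : Continuous f) (hker : f.ker ≤ Subgroup.center _)
    (hC : ∀ C ≤ Subgroup.center (SpecialLinearGroup ι K), C.comap (map j) = f.ker →
      C ≤ (map j).range)
    {W : Set (SpecialLinearGroup ι F)} (hW : IsOpen W) (hkW : (f.ker : Set _) ⊆ W) :
    W ∈ comap f (𝓝 1) := by
  have hφ := isInducing_map (ι := ι) hj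
  have hinf : Infinite K := NontriviallyNormedField.infinite K
  have hcomap := comap_clusterSubgroup hφ hf
  have hcenter : clusterSubgroup (map j) f ≤ Subgroup.center _ := by
    have := clusterSubgroup_normal (f := f) (denseRange_map (ι := ι) hd)
    refine (normal_le_center_or_eq_top (clusterSubgroup (map j) f)).resolve_right fun h ↦ ?_
    rw [h, Subgroup.comap_top] at hcomap
    obtain ⟨p, q, hpq⟩ := exists_pair_ne ι
    exact one_ne_zero ((transvection_mem_center_iff hpq (1 : F)).1
      (hker (hcomap ▸ Subgroup.mem_top _)))
  obtain ⟨V, hV, R, hR⟩ := exists_norm_entry_le_of_clusterSubgroup_le_center hj hd hf hcenter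
  exact mem_comap_nhds_one_of_isCompact hφ hf (hC _ hcenter hcomap) hV
    (isCompact_setOf_norm_entry_le ι K R) hR hW hkW

/-- A sufficient criterion for the minimality of a quotient of `SL(ι, F)` by a central subgroup,
in terms of central subgroups of `SL(ι, K)`, with `K` the completion of `F`. -/
theorem isMinimal_of_isOpenQuotientMap [Nontrivial ι] {j : F →+* K}
    (hj : IsInducing j) (hd : DenseRange j) {Q : Type*} [Group Q] [τ : TopologicalSpace Q]
    [IsTopologicalGroup Q] {q : SpecialLinearGroup ι F →* Q} (hq : IsOpenQuotientMap q)
    (hker : q.ker ≤ Subgroup.center _)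
    (hC : ∀ C ≤ Subgroup.center (SpecialLinearGroup ι K), C.comap (map j) = q.ker →
      C ≤ (map j).range) : IsMinimal Q := by
  intro σ hσ hT2
  have hf : @Continuous _ _ _ σ.toTopologicalSpace q := continuous_le_rng hσ hq.continuous
  refine IsTopologicalGroup.ext σ.toIsTopologicalGroup ‹_› (le_antisymm ?_ (nhds_mono hσ))
  intro U hU
  obtain ⟨O, hOU, hO, h1O⟩ := mem_nhds_iff.1 hU
  obtain ⟨V, hV, hVO⟩ := @mem_comap_nhds_one _ _ _ _ _ _ _ _ _ _ _ _ hj hd Q _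
    σ.toTopologicalSpace σ.toIsTopologicalGroup hT2 q hf hker hC _ (hO.preimage hq.continuous)
    fun x hx ↦ by rwa [Set.mem_preimage, MonoidHom.mem_ker.1 hx]
  filter_upwards [hV] with x hx
  obtain ⟨g, rfl⟩ := hq.surjective x
  exact hOU (hVO hx)

end NonEscape
end Matrix.SpecialLinearGroup

lemma IsMinimal.of_subsingleton (G : Type*) [Group G] [TopologicalSpace G] [Subsingleton G] :
    IsMinimal G := fun _ _ _ ↦ Subsingleton.elim _ _

lemma Subgroup.mem_of_zpow_mem_of_isCoprime {G : Type*} [Group G] {H : Subgroup G} {c : G}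
    {k l : ℤ} (h : IsCoprime k l) (hk : c ^ k ∈ H) (hl : c ^ l ∈ H) : c ∈ H := by
  obtain ⟨u, v, huv⟩ := h
  rw [← zpow_one c, ← huv, _root_.zpow_add, mul_comm u, mul_comm v, _root_.zpow_mul, _root_.zpow_mul]
  exact mul_mem (zpow_mem hk _) (zpow_mem hl _)

lemma Subgroup.mem_of_pow_squarefree_eq_one {G : Type*} [Group G] {Z H : Subgroup G}
    (h : ∀ p : ℕ, p.Prime → ∀ c ∈ Z, c ^ p = 1 → c ∈ H) {m : ℕ} (hm : Squarefree m) {c : G}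
    (hc : c ∈ Z) (hcm : c ^ m = 1) : c ∈ H := by
  induction m using induction_on_primes generalizing c with
  | zero => exact absurd hm not_squarefree_zero
  | one => simp_all
  | prime_mul p a hp ih =>
    obtain ⟨hpa, -, ha⟩ := Nat.squarefree_mul_iff.1 hm
    refine mem_of_zpow_mem_of_isCoprime (k := p) (l := a) (Nat.isCoprime_iff_coprime.2 hpa) ?_ ?_
    · rw [zpow_natCast]
      exact ih ha (pow_mem hc _) (by rw [← pow_mul, hcm])
    · rw [zpow_natCast]
      exact h p hp _ (pow_mem hc _) (by rw [← pow_mul, mul_comm, hcm])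

namespace Matrix.SpecialLinearGroup

variable {ι F K : Type*} [Fintype ι] [DecidableEq ι]

lemma pow_card_eq_one_of_mem_center [CommRing K] {c : SpecialLinearGroup ι K}
    (hc : c ∈ Subgroup.center (SpecialLinearGroup ι K)) : c ^ Fintype.card ι = 1 := by
  obtain ⟨r, hr, hrc⟩ := mem_center_iff.1 hc
  apply Subtype.ext
  rw [coe_pow, ← hrc, ← map_pow, hr, map_one, coe_one]

lemma injective_map [CommRing F] [CommRing K] {j : F →+* K} (hj : Function.Injective j) :
    Function.Injective (map (n := ι) j) :=
  fun _ _ h ↦ Subtype.ext (Matrix.map_injective hj (congr_arg Subtype.val h))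

variable [Field F] [TopologicalSpace F] [IsTopologicalRing F] [NontriviallyNormedField K]
  [ProperSpace K] [Nontrivial ι] {j : F →+* K}

/-- `SL(ι, F)` is minimal iff it contains the central elements of prime order of `SL(ι, K)`, with
`K` the completion of `F`. -/
theorem isMinimal_iff (hj : IsInducing j) (hd : DenseRange j) :
    IsMinimal (SpecialLinearGroup ι F) ↔ ∀ p : ℕ, p.Prime →
      ∀ c ∈ Subgroup.center (SpecialLinearGroup ι K), c ^ p = 1 → c ∈ (map j).range := by
  have hφ := isInducing_map (ι := ι) hj
  have hker : (MonoidHom.id (SpecialLinearGroup ι F)).ker = ⊥ := rfl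
  refine ⟨fun hmin p hp c hc hcp ↦ ?_, fun h ↦ ?_⟩
  · by_contra hcr
    have hfin : Finite (Subgroup.zpowers c) :=
      (isOfFinOrder_iff_pow_eq_one.2 ⟨p, hp.pos, hcp⟩).finite_zpowers
    refine hcr (hmin.le_range (q := .id _) .id hφ (denseRange_map hd)
      (Subgroup.zpowers_le.2 hc) ?_ (Subgroup.mem_zpowers c))
    rw [hker, eq_bot_iff]
    intro g hg
    obtain ⟨k, hk⟩ := Subgroup.mem_zpowers_iff.1 (Subgroup.mem_comap.1 hg)
    rw [Subgroup.mem_bot]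
    apply injective_map j.injective
    rw [← hk, map_one]
    have hpk : (p : ℤ) ∣ k := by
      by_contra hpk
      refine hcr (Subgroup.mem_of_zpow_mem_of_isCoprime
        ((Nat.prime_iff_prime_int.1 hp).coprime_iff_not_dvd.2 hpk) ?_ ⟨g, hk.symm⟩)
      simp [hcp]
    obtain ⟨l, rfl⟩ := hpk
    rw [_root_.zpow_mul, zpow_natCast, hcp, _root_.one_zpow]
  · refine isMinimal_of_isOpenQuotientMap hj hd (q := .id _) .id (by simp [hker])
      fun C hC hC' c hc ↦ ?_
    suffices c = 1 from this ▸ one_mem _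
    by_contra hne
    have hfin : 0 < orderOf c := orderOf_pos_iff.2 <| isOfFinOrder_iff_pow_eq_one.2
      ⟨_, Fintype.card_pos, pow_card_eq_one_of_mem_center (hC hc)⟩
    obtain ⟨p, hp, d, hpd⟩ := Nat.exists_prime_and_dvd (mt orderOf_eq_one_iff.1 hne)
    have hd0 : 0 < d := Nat.pos_of_ne_zero fun h ↦ by simp [h] at hpd; simp [hpd] at hfin
    obtain ⟨g, hg⟩ := h p hp (c ^ d) (pow_mem (hC hc) _)
      (by rw [← pow_mul, mul_comm, ← hpd, pow_orderOf_eq_one])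
    have hg1 : g ∈ C.comap (map j) := by
      rw [Subgroup.mem_comap, hg]
      exact pow_mem hc _
    rw [hC', hker, Subgroup.mem_bot] at hg1
    rw [hg1, map_one] at hg
    have := Nat.le_of_dvd hd0 (orderOf_dvd_of_pow_eq_one hg.symm)
    nlinarith [hp.two_le]

/-- `SL(ι, F)` is totally minimal iff it contains the center of `SL(ι, K)`, with
`K` the completion of `F`. -/
theorem isTotallyMinimal_iff [Infinite F] (hj : IsInducing j) (hd : DenseRange j) :
    IsTotallyMinimal (SpecialLinearGroup ι F) ↔
      Subgroup.center (SpecialLinearGroup ι K) ≤ (map j).range := by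
  have hφ := isInducing_map (ι := ι) hj
  refine ⟨fun h c hc ↦ ?_, fun h N hN _ ↦ ?_⟩
  · have hcfin : IsOfFinOrder c :=
      isOfFinOrder_iff_pow_eq_one.2 ⟨_, Fintype.card_pos, pow_card_eq_one_of_mem_center hc⟩
    have hfin : Finite (Subgroup.zpowers c) := hcfin.finite_zpowers
    have hle := Subgroup.zpowers_le.2 hc
    have hnormal : (Subgroup.zpowers c).Normal := ⟨fun n hn g ↦ by
      rwa [Subgroup.mem_center_iff.1 (hle hn) g, mul_inv_cancel_right]⟩
    refine (h ((Subgroup.zpowers c).comap (map j)) ?_).le_range QuotientGroup.isOpenQuotientMap_mk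
      (q := QuotientGroup.mk' _) hφ (denseRange_map hd) hle (QuotientGroup.ker_mk' _).symm
      (Subgroup.mem_zpowers c)
    exact (Set.toFinite (Subgroup.zpowers c : Set _)).isClosed.preimage hφ.continuous
  · obtain hN' | rfl := normal_le_center_or_eq_top N
    · exact isMinimal_of_isOpenQuotientMap hj hd (q := QuotientGroup.mk' N)
        QuotientGroup.isOpenQuotientMap_mk (by rwa [QuotientGroup.ker_mk'])
        fun C hC _ ↦ hC.trans h
    · have : Subsingleton (SpecialLinearGroup ι F ⧸ (⊤ : Subgroup (SpecialLinearGroup ι F))) :=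
        QuotientGroup.subsingleton_quotient_top
      exact .of_subsingleton _

end Matrix.SpecialLinearGroup

namespace Subfield

/-- The nontrivially normed field structure on a subfield of `ℂ`. -/
noncomputable abbrev nontriviallyNormedField (K : Subfield ℂ) : NontriviallyNormedField K where
  toNormedField := inferInstance
  non_trivial := ⟨2, by
    change 1 < ‖(2 : ℂ)‖
    simp⟩

lemma properSpace_topologicalClosure (F : Subfield ℂ) : ProperSpace F.topologicalClosure :=
  .of_isClosed F.isClosed_topologicalClosure

lemma isInducing_inclusion {F K : Subfield ℂ} (h : F ≤ K) : IsInducing (inclusion h) :=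
  IsInducing.of_comp (continuous_inclusion h) continuous_subtype_val IsInducing.subtypeVal

lemma denseRange_inclusion_topologicalClosure (F : Subfield ℂ) :
    DenseRange (inclusion F.le_topologicalClosure) :=
  (denseRange_inclusion_iff F.le_topologicalClosure).2 subset_rfl

end Subfield

section RootsOfUnity

lemma Nat.totient_lt_totient_lcm_sq {M p : ℕ} (hM : Squarefree M) (hp : p.Prime) (hpM : p ∣ M) :
    M.totient < (M.lcm (p ^ 2)).totient := by
  have hlcm : M.lcm (p ^ 2) = p * M := by
    obtain ⟨m, rfl⟩ := hpM
    have hcop : p.Coprime m := (Nat.squarefree_mul_iff.1 hM).1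
    rw [sq, Nat.lcm_mul_left, hcop.symm.lcm_eq_mul, mul_comm m]
  rw [hlcm, Nat.totient_mul_of_prime_of_dvd hp hpM]
  have := Nat.totient_pos.2 (Nat.pos_of_ne_zero hM.ne_zero)
  nlinarith [hp.two_le]

open IntermediateField in
lemma IsPrimitiveRoot.notMem_adjoin {ζ z : ℂ} {M m : ℕ} [NeZero M] [NeZero m]
    (hζ : IsPrimitiveRoot ζ M) (hz : IsPrimitiveRoot z m)
    (h : M.totient < (M.lcm m).totient) : z ∉ ℚ⟮ζ⟯ := by
  intro hzF
  have : IsCyclotomicExtension {M} ℚ ℚ⟮ζ⟯ := by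
    change IsCyclotomicExtension {M} ℚ ℚ⟮ζ⟯.toSubalgebra
    rw [adjoin_simple_toSubalgebra_of_isAlgebraic
      ((hζ.isIntegral (NeZero.pos M)).tower_top (A := ℚ)).isAlgebraic]
    exact hζ.adjoin_isCyclotomicExtension ℚ
  have : FiniteDimensional ℚ ℚ⟮ζ⟯ := IsCyclotomicExtension.finiteDimensional {M} ℚ _
  have hl : 0 < M.lcm m := Nat.lcm_pos (NeZero.pos M) (NeZero.pos m)
  have hx : IsPrimitiveRoot (⟨ζ, mem_adjoin_simple_self ℚ ζ⟩ : ℚ⟮ζ⟯) M :=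
    .of_map_of_injective (f := ℚ⟮ζ⟯.val) hζ Subtype.val_injective
  have hy : IsPrimitiveRoot (⟨z, hzF⟩ : ℚ⟮ζ⟯) m :=
    .of_map_of_injective (f := ℚ⟮ζ⟯.val) hz Subtype.val_injective
  have hle := hx.lcm_totient_le_finrank hy (Polynomial.cyclotomic.irreducible_rat hl)
  rw [IsCyclotomicExtension.finrank (n := M) _
    (Polynomial.cyclotomic.irreducible_rat (NeZero.pos M))] at hle
  omega

/-- For `p ^ 2 ∣ n`, there is a dense subfield of `ℂ` containing the roots of unity of prime order
dividing `n`, but not those of order `p ^ 2`. -/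
lemma exists_subfield_roots_of_unity {n p : ℕ} (hp : p.Prime) (hpn : p ∣ n) (hn : n ≠ 0) :
    ∃ F : Subfield ℂ, F.topologicalClosure = ⊤ ∧
      (∀ q : ℕ, q.Prime → q ∣ n → ∀ z : ℂ, z ^ q = 1 → z ∈ F) ∧
      ∀ z : ℂ, IsPrimitiveRoot z (p ^ 2) → z ∉ F := by
  have h3n : 3 * n ≠ 0 := by omega
  set M := UniqueFactorizationMonoid.radical (3 * n) with hM
  have hM0 : M ≠ 0 := UniqueFactorizationMonoid.radical_ne_zero
  have hMdvd {q : ℕ} (hq : q.Prime) (h : q ∣ 3 * n) : q ∣ M :=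
    (UniqueFactorizationMonoid.dvd_radical_iff_of_irreducible hq h3n).2 h
  have := NeZero.mk hM0
  have := NeZero.mk (pow_ne_zero 2 hp.ne_zero)
  have hζ := Complex.isPrimitiveRoot_exp M hM0
  set ζ := Complex.exp (2 * Real.pi * Complex.I / M)
  have hmem (q : ℕ) (hq : q.Prime) (hqn : q ∣ 3 * n) (z : ℂ) (hz : z ^ q = 1) :
      z ∈ (IntermediateField.adjoin ℚ {ζ}).toSubfield := by
    obtain ⟨l, hl⟩ := hMdvd hq hqn
    obtain ⟨i, -, rfl⟩ := hζ.eq_pow_of_pow_eq_one (ξ := z) (by rw [hl, pow_mul, hz, one_pow])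
    exact pow_mem (IntermediateField.mem_adjoin_simple_self ℚ ζ) i
  refine ⟨(IntermediateField.adjoin ℚ {ζ}).toSubfield, ?_,
    fun q hq hqn ↦ hmem q hq (hqn.mul_left 3), fun z hz ↦ hζ.notMem_adjoin hz
      (Nat.totient_lt_totient_lcm_sq UniqueFactorizationMonoid.squarefree_radical hp
        (hMdvd hp (hpn.mul_left 3)))⟩
  set F := (IntermediateField.adjoin ℚ {ζ}).toSubfield
  refine (Complex.subfield_eq_of_closed F.isClosed_topologicalClosure).resolve_left fun h ↦ ?_
  have hω := Complex.isPrimitiveRoot_exp 3 three_ne_zero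
  have hmem3 := F.le_topologicalClosure (hmem 3 Nat.prime_three (dvd_mul_right 3 n) _ hω.pow_eq_one)
  rw [h] at hmem3
  obtain ⟨x, hx⟩ := hmem3
  have hx3 : x ^ 3 = 1 := by
    have := hω.pow_eq_one
    rw [← hx] at this
    exact Complex.ofReal_injective (by simpa using this)
  have hx1 : x = 1 := by nlinarith [sq_nonneg (x + 1), sq_nonneg (x - 1)]
  refine hω.ne_one (by norm_num) ?_
  rw [← hx, hx1, map_one]

end RootsOfUnity

namespace Matrix.SpecialLinearGroup

lemma mem_range_map_iff {ι F K : Type*} [Fintype ι] [DecidableEq ι] [Nonempty ι] [Field F] [Field K]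
    {j : F →+* K} {c : SpecialLinearGroup ι K} {r : K} (hc : scalar ι r = (c : Matrix ι ι K)) :
    c ∈ (map j).range ↔ r ∈ j.range := by
  obtain ⟨i⟩ := ‹Nonempty ι›
  constructor
  · rintro ⟨g, rfl⟩
    refine ⟨g i i, ?_⟩
    simpa using (congr_fun₂ hc i i).symm
  · rintro ⟨x, rfl⟩
    have hx : (scalar ι x).det = 1 := by
      apply j.injective
      rw [j.map_det, map_one, ← c.det_coe, ← hc]
      congr 1
      ext a b
      simp [diagonal_apply, apply_ite j]
    refine ⟨⟨scalar ι x, hx⟩, ?_⟩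
    apply Subtype.ext
    rw [← hc]
    ext a b
    change j (scalar ι x a b) = scalar ι (j x) a b
    simp [diagonal_apply, apply_ite j]

end Matrix.SpecialLinearGroup

end

/-- For a positive integer `n`: `n` is not square-free if and only if
there exists a subfield `F` of `ℂ` (with the subspace topology) such that `SL(n,F)` is
minimal but not totally minimal. -/
theorem not_squarefree_iff_exists_sl_minimal_not_totallyMinimal
    (n : ℕ) (hn : 0 < n) :
    ¬ Squarefree n ↔
      ∃ F : Subfield ℂ, IsMinimal (Matrix.SpecialLinearGroup (Fin n) ↥F) ∧
        ¬ IsTotallyMinimal (Matrix.SpecialLinearGroup (Fin n) ↥F) := by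
  constructor
  · intro h
    rw [Nat.squarefree_iff_prime_squarefree] at h
    push Not at h
    obtain ⟨p, hp, hpn⟩ := h
    have hn1 : 1 < n := hp.one_lt.trans_le (Nat.le_of_dvd hn (dvd_of_mul_right_dvd hpn))
    have := Fin.nontrivial_iff_two_le.2 hn1
    obtain ⟨F, hF, hroots, hz⟩ := exists_subfield_roots_of_unity hp (dvd_of_mul_right_dvd hpn) hn.ne'
    let _ := F.topologicalClosure.nontriviallyNormedField
    have := F.properSpace_topologicalClosure
    have hj := Subfield.isInducing_inclusion F.le_topologicalClosure
    have hd := F.denseRange_inclusion_topologicalClosure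
    refine ⟨F, ?_, ?_⟩
    · rw [Matrix.SpecialLinearGroup.isMinimal_iff hj hd]
      intro q hq c hc hcq
      obtain ⟨r, hrn, hr⟩ := Matrix.SpecialLinearGroup.mem_center_iff.1 hc
      rw [Fintype.card_fin] at hrn
      have hrq : r ^ q = 1 := by
        have := congr_arg Subtype.val hcq
        rw [Matrix.SpecialLinearGroup.coe_pow, ← hr, ← map_pow, Matrix.SpecialLinearGroup.coe_one] at this
        simpa using congr_fun₂ this ⟨0, hn⟩ ⟨0, hn⟩
      have : NeZero n := ⟨hn.ne'⟩
      rw [Matrix.SpecialLinearGroup.mem_range_map_iff hr]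
      by_cases hqn : q ∣ n
      · exact ⟨⟨r, hroots q hq hqn r (congr_arg Subtype.val hrq)⟩, rfl⟩
      · have : r = 1 := by
          have hcop := (hq.coprime_iff_not_dvd.2 hqn)
          rw [← orderOf_eq_one_iff, ← Nat.dvd_one, ← hcop]
          exact Nat.dvd_gcd (orderOf_dvd_of_pow_eq_one hrq) (orderOf_dvd_of_pow_eq_one hrn)
        exact this ▸ one_mem _
    · rw [Matrix.SpecialLinearGroup.isTotallyMinimal_iff hj hd]
      intro hle
      have hζ := Complex.isPrimitiveRoot_exp (p ^ 2) (pow_ne_zero 2 hp.ne_zero)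
      set ζ := Complex.exp (2 * Real.pi * Complex.I / (p ^ 2 : ℕ))
      let r : F.topologicalClosure := ⟨ζ, hF ▸ Subfield.mem_top _⟩
      have hrn : r ^ n = 1 := Subtype.ext ((hζ.pow_eq_one_iff_dvd n).2 (by rwa [sq]))
      have : NeZero n := ⟨hn.ne'⟩
      let c : Matrix.SpecialLinearGroup (Fin n) F.topologicalClosure := ⟨Matrix.scalar _ r, by simpa using hrn⟩
      have hc := hle (Matrix.SpecialLinearGroup.mem_center_iff.2 ⟨r, by simpa using hrn, rfl⟩ : c ∈ _)
      obtain ⟨x, hx⟩ := (Matrix.SpecialLinearGroup.mem_range_map_iff rfl).1 hc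
      have hxζ : (x : ℂ) = ζ := congr_arg Subtype.val hx
      exact hz ζ hζ (hxζ ▸ x.2)
  · rintro ⟨F, hmin, htot⟩ hsq
    refine htot ?_
    obtain rfl | hn1 := Nat.eq_or_lt_of_le (Nat.succ_le_of_lt hn)
    · exact fun N _ _ ↦ .of_subsingleton _
    have := Fin.nontrivial_iff_two_le.2 hn1
    let _ := F.topologicalClosure.nontriviallyNormedField
    have := F.properSpace_topologicalClosure
    have hj := Subfield.isInducing_inclusion F.le_topologicalClosure
    have hd := F.denseRange_inclusion_topologicalClosure
    rw [Matrix.SpecialLinearGroup.isMinimal_iff hj hd] at hmin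
    rw [Matrix.SpecialLinearGroup.isTotallyMinimal_iff hj hd]
    exact fun c hc ↦ Subgroup.mem_of_pow_squarefree_eq_one hmin hsq hc
      (by simpa using Matrix.SpecialLinearGroup.pow_card_eq_one_of_mem_center hc)
end

section
/- For a positive integer n, the following are equivalent: n is not square-free if and only if there exists a subfield F of the field ℂ of complex numbers (with the subspace topology) such that STP(n,F) is minimal but not z-minimal. -/
/-- `STP(n,F)`: the special upper triangular group, i.e. the subgroup of `SL(n,F)`
consisting of the upper triangular matrices (it carries the subspace topology). -/
def STP (n : ℕ) (F : Type*) [Field F] : Subgroup (Matrix.SpecialLinearGroup (Fin n) F) where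
  carrier := { A | ((A : Matrix (Fin n) (Fin n) F)).BlockTriangular id }
  one_mem' := by
    simpa using Matrix.blockTriangular_one
  mul_mem' := by
    intro a b ha hb
    simpa using Matrix.BlockTriangular.mul ha hb
  inv_mem' := by
    intro a ha
    have h2 : IsUnit ((a : Matrix (Fin n) (Fin n) F)).det := by simp
    haveI := (a : Matrix (Fin n) (Fin n) F).invertibleOfIsUnitDet h2
    have h1 : ((a : Matrix (Fin n) (Fin n) F))⁻¹
        = ((a⁻¹ : Matrix.SpecialLinearGroup (Fin n) F) : Matrix (Fin n) (Fin n) F) := by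
      apply Matrix.inv_eq_right_inv
      rw [← Matrix.SpecialLinearGroup.coe_mul]
      simp
    have h3 := Matrix.blockTriangular_inv_of_blockTriangular
      (M := (a : Matrix (Fin n) (Fin n) F)) (b := id) ha
    rw [h1] at h3
    exact h3

open Filter Topology Matrix

namespace STP

section Algebra

variable {n : ℕ} {F : Type*} [Field F]

/-- The underlying matrix of an element of `STP n F`, as a monoid homomorphism. -/
def mat : STP n F →* Matrix (Fin n) (Fin n) F where
  toFun g := g.1.1
  map_one' := rfl
  map_mul' _ _ := rfl

theorem mat_injective : Function.Injective (mat : STP n F →* Matrix (Fin n) (Fin n) F) :=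
  fun _ _ h => Subtype.ext (Subtype.ext h)

theorem mat_apply_of_lt (g : STP n F) {i j : Fin n} (h : j < i) : mat g i j = 0 := g.2 h

theorem prod_mat_diag (g : STP n F) : ∏ i, mat g i i = 1 := by
  have h : (mat g).det = 1 := g.1.2
  rwa [det_of_isUpperTriangular (M := mat g) g.2] at h

theorem mat_diag_ne_zero (g : STP n F) (i : Fin n) : mat g i i ≠ 0 := fun h =>
  one_ne_zero ((prod_mat_diag g).symm.trans (Finset.prod_eq_zero (Finset.mem_univ i) h))

/-- An upper triangular matrix whose diagonal entries have product `1`. -/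
def ofMat (A : Matrix (Fin n) (Fin n) F) (h : A.BlockTriangular id) (hd : ∏ i, A i i = 1) :
    STP n F :=
  ⟨⟨A, (det_of_isUpperTriangular h).trans hd⟩, h⟩

/-- The diagonal matrix with entries `d`. -/
def diag (d : Fin n → F) (hd : ∏ i, d i = 1) : STP n F :=
  ofMat (diagonal d) (blockTriangular_diagonal d) (by simpa using hd)

@[simp]
theorem mat_diag (d : Fin n → F) (hd : ∏ i, d i = 1) : mat (diag d hd) = diagonal d := rfl

variable {k : ℕ}

theorem mat_mul_last (g h : STP (k + 1) F) :
    mat (g * h) (Fin.last k) (Fin.last k)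
      = mat g (Fin.last k) (Fin.last k) * mat h (Fin.last k) (Fin.last k) := by
  rw [map_mul, mul_apply]
  refine Finset.sum_eq_single _ (fun j _ hj => ?_) (by simp)
  rw [mat_apply_of_lt g (Fin.lt_last_iff_ne_last.2 hj), zero_mul]

/-- The last diagonal entry, as a homomorphism. -/
def lastEntry : STP (k + 1) F →* F where
  toFun g := mat g (Fin.last k) (Fin.last k)
  map_one' := by simp
  map_mul' := mat_mul_last

theorem lastEntry_apply (g : STP (k + 1) F) :
    lastEntry g = mat g (Fin.last k) (Fin.last k) := rfl

theorem lastEntry_ne_zero (g : STP (k + 1) F) : lastEntry g ≠ 0 := mat_diag_ne_zero g _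

/-- The unipotent matrix whose last column is `v` above the diagonal. -/
def col (v : Fin k → F) : STP (k + 1) F :=
  ofMat (1 + vecMulVec (Fin.snoc v 0) (Pi.single (Fin.last k) 1))
    (by
      intro i j h
      have hj : j ≠ Fin.last k := (h.trans_le (Fin.le_last _)).ne
      have hi : i ≠ j := h.ne'
      simp [vecMulVec_apply, one_apply, hj, hi])
    (by
      refine Finset.prod_eq_one fun i _ => ?_
      induction i using Fin.lastCases <;> simp [vecMulVec_apply])

theorem mat_col (v : Fin k → F) :
    mat (col v) = 1 + vecMulVec (Fin.snoc v 0 : Fin (k + 1) → F) (Pi.single (Fin.last k) 1) := rfl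

theorem mat_col_mul (v : Fin k → F) (A : Matrix (Fin (k + 1)) (Fin (k + 1)) F)
    (i j : Fin (k + 1)) :
    (mat (col v) * A) i j
      = A i j + (Fin.snoc v 0 : Fin (k + 1) → F) i * A (Fin.last k) j := by
  rw [mat_col, add_mul, vecMulVec_mul]
  simp [vecMulVec_apply]

theorem mul_mat_col (v : Fin k → F) (A : Matrix (Fin (k + 1)) (Fin (k + 1)) F)
    (i j : Fin (k + 1)) :
    (A * mat (col v)) i j
      = A i j + (∑ l : Fin k, A i l.castSucc * v l) * (if j = Fin.last k then 1 else 0) := by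
  rw [mat_col, mul_add, mul_vecMulVec]
  simp [vecMulVec_apply, mulVec, dotProduct, Fin.sum_univ_castSucc, Pi.single_apply]

theorem col_add (v w : Fin k → F) : col (v + w) = col v * col w := by
  apply mat_injective
  ext i j
  rw [map_mul, mat_col_mul, mat_col, mat_col]
  induction i using Fin.lastCases with
  | last => simp [vecMulVec_apply]
  | cast i =>
    by_cases hj : j = Fin.last k <;> simp [hj, vecMulVec_apply, one_apply, eq_comm]
    ring

theorem col_zero : col (0 : Fin k → F) = 1 := by
  have := col_add (0 : Fin k → F) 0
  simpa using this

theorem col_neg (v : Fin k → F) : col (-v) = (col v)⁻¹ :=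
  eq_inv_of_mul_eq_one_left (by rw [← col_add, neg_add_cancel, col_zero])

theorem col_sub (v w : Fin k → F) : col (v - w) = col v * (col w)⁻¹ := by
  rw [sub_eq_add_neg, col_add, col_neg]

theorem col_injective : Function.Injective (col : (Fin k → F) → STP (k + 1) F) := by
  intro v w h
  funext i
  have := congrFun (congrFun (congrArg mat h) i.castSucc) (Fin.last k)
  simpa [mat_col, vecMulVec_apply] using this

/-- Conjugation acts on the last column linearly. -/
theorem conj_col (g : STP (k + 1) F) (v : Fin k → F) :
    g * col v * g⁻¹
      = col fun i => (∑ l : Fin k, mat g i.castSucc l.castSucc * v l) / lastEntry g := by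
  rw [mul_inv_eq_iff_eq_mul]
  apply mat_injective
  ext i j
  have hg := lastEntry_ne_zero g
  rw [map_mul, map_mul, mul_mat_col, mat_col_mul]
  congr 1
  have hj : j ≠ Fin.last k → mat g (Fin.last k) j = 0 := fun hj =>
    mat_apply_of_lt g (Fin.lt_last_iff_ne_last.2 hj)
  induction i using Fin.lastCases with
  | last => simp [mat_apply_of_lt g (Fin.castSucc_lt_last _)]
  | cast i =>
    by_cases h : j = Fin.last k
    · subst h
      simp only [Fin.snoc_castSucc, if_true, mul_one, ← lastEntry_apply]
      field_simp
    · simp [h, hj h]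

/-- The diagonal matrix `(t, …, t, t⁻ᵏ)`. -/
def almostScalar (t : Fˣ) : STP (k + 1) F :=
  diag (Fin.snoc (fun _ : Fin k => (t : F)) ((t⁻¹ ^ k : Fˣ) : F))
    (by simp [Fin.prod_univ_castSucc])

theorem mat_almostScalar (t : Fˣ) :
    mat (almostScalar t : STP (k + 1) F)
      = diagonal (Fin.snoc (fun _ : Fin k => (t : F)) ((t⁻¹ ^ k : Fˣ) : F)) := rfl

theorem almostScalar_inv (t : Fˣ) :
    (almostScalar t⁻¹ : STP (k + 1) F) = (almostScalar t)⁻¹ := by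
  refine eq_inv_of_mul_eq_one_left (mat_injective ?_)
  rw [map_mul, mat_almostScalar, mat_almostScalar, diagonal_mul_diagonal, map_one,
    ← diagonal_one]
  congr 1
  funext i
  induction i using Fin.lastCases <;> simp

/-- The commutator with `(t, …, t, t⁻ᵏ)` isolates the last column. -/
theorem commutator_almostScalar (g : STP (k + 1) F) (t : Fˣ) :
    g * almostScalar t * g⁻¹ * (almostScalar t)⁻¹
      = col fun i => (1 - (t : F) ^ (k + 1)) * (mat g i.castSucc (Fin.last k) / lastEntry g) := by
  rw [mul_inv_eq_iff_eq_mul, mul_inv_eq_iff_eq_mul]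
  apply mat_injective
  ext i j
  have hg := lastEntry_ne_zero g
  rw [map_mul, mul_assoc, map_mul, map_mul, mat_col_mul, mat_almostScalar, mul_diagonal,
    diagonal_mul, diagonal_mul]
  induction i using Fin.lastCases with
  | last =>
    induction j using Fin.lastCases with
    | last => simp [mul_comm]
    | cast j => simp [mat_apply_of_lt g (Fin.castSucc_lt_last _)]
  | cast i =>
    induction j using Fin.lastCases with
    | last =>
      have ht : (t : F) ≠ 0 := t.ne_zero
      simp only [Fin.snoc_castSucc, Fin.snoc_last, ← lastEntry_apply]
      rw [show ((t⁻¹ ^ k : Fˣ) : F) = ((t : F) ^ k)⁻¹ by simp]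
      field_simp
      ring
    | cast j => simp [mat_apply_of_lt g (Fin.castSucc_lt_last _), mul_comm]

/-- The elementary matrix adding row `j + 1` to row `0`. -/
def addRow (j : Fin k) : STP (k + 2) F :=
  ofMat (1 + single 0 j.succ.castSucc 1)
    (by
      intro a b h
      have hab : a ≠ b := h.ne'
      rw [Matrix.add_apply, one_apply_ne hab, zero_add]
      refine single_apply_of_ne _ _ _ _ _ fun h2 => ?_
      rw [← h2.1] at h
      exact absurd h (Fin.not_lt_zero _))
    (by
      refine Finset.prod_eq_one fun i _ => ?_
      rw [Matrix.add_apply, one_apply_eq, single_apply_of_ne, add_zero]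
      rintro ⟨h, h2⟩
      rw [← h, ← Fin.castSucc_zero, Fin.castSucc_inj] at h2
      exact Fin.succ_ne_zero _ h2)

theorem mat_addRow (j : Fin k) :
    mat (addRow j : STP (k + 2) F) = 1 + single 0 j.succ.castSucc 1 := rfl

theorem commutator_addRow (j : Fin k) (v : Fin (k + 1) → F) :
    (addRow j * col v * (addRow j)⁻¹ * (col v)⁻¹ : STP (k + 2) F)
      = col (Pi.single 0 (v j.succ)) := by
  have hlast : lastEntry (addRow j : STP (k + 2) F) = 1 := by
    rw [lastEntry_apply, mat_addRow, Matrix.add_apply, one_apply_eq, single_apply_of_ne,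
      add_zero]
    rintro ⟨h, -⟩
    exact (Fin.last_pos.ne h)
  rw [conj_col, ← col_sub]
  congr 1
  funext i
  simp only [hlast, div_one, mat_addRow, Matrix.add_apply, add_mul, Finset.sum_add_distrib,
    Pi.sub_apply, one_apply, single_apply, Fin.castSucc_inj]
  by_cases h : i = 0
  · subst h
    simp
  · have h2 : (0 : Fin (k + 2)) ≠ i.castSucc := by
      rw [← Fin.castSucc_zero, Ne, Fin.castSucc_inj]
      exact Ne.symm h
    simp [h, h2]

/-- The diagonal matrix `(t, 1, …, 1, t⁻¹)`. -/
def cornerScaling (t : Fˣ) : STP (k + 2) F :=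
  diag (Fin.snoc (Fin.cons (t : F) (fun _ : Fin k => 1)) ((t⁻¹ : Fˣ) : F))
    (by simp [Fin.prod_univ_castSucc (n := k + 1), Fin.prod_univ_succ])

theorem cornerScaling_conj (t : Fˣ) (b : F) :
    cornerScaling t * col (Pi.single (0 : Fin (k + 1)) b) * (cornerScaling t)⁻¹
      = col (Pi.single 0 (t ^ 2 * b)) := by
  rw [conj_col]
  congr 1
  funext i
  have ht : (t : F) ≠ 0 := t.ne_zero
  simp only [cornerScaling, mat_diag, lastEntry_apply, diagonal_apply, Fin.castSucc_inj, ite_mul,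
    zero_mul, Finset.sum_ite_eq, Finset.mem_univ, if_true, Fin.snoc_castSucc, Fin.snoc_last]
  induction i using Fin.cases with
  | zero => simp; ring
  | succ i => simp

theorem mem_center_of_mat_eq_smul_one {n : ℕ} {g : STP n F} {c : F} (h : mat g = c • 1) :
    g ∈ Subgroup.center (STP n F) := by
  rw [Subgroup.mem_center_iff]
  intro x
  apply mat_injective
  rw [map_mul, map_mul, h]
  simp

theorem mat_eq_smul_one_of_mem_center [CharZero F] {g : STP (k + 1) F}
    (h : g ∈ Subgroup.center (STP (k + 1) F)) : mat g = lastEntry g • 1 := by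
  rw [Subgroup.mem_center_iff] at h
  have hg := lastEntry_ne_zero g
  ext i j
  induction j using Fin.lastCases with
  | last =>
    induction i using Fin.lastCases with
    | last => simp [lastEntry_apply]
    | cast i =>
      have h2 := commutator_almostScalar g (Units.mk0 (2 : F) two_ne_zero)
      rw [← h, mul_inv_cancel_right, mul_inv_cancel, ← col_zero] at h2
      have h3 := congrFun (col_injective h2) i
      have h4 : (1 - (2 : F) ^ (k + 1)) ≠ 0 := by
        rw [sub_ne_zero]
        exact_mod_cast (Nat.one_lt_two_pow (Nat.succ_ne_zero k)).ne
      simp only [Pi.zero_apply, Units.val_mk0, zero_eq_mul, h4, div_eq_zero_iff, hg, or_false,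
        false_or] at h3
      simp [h3]
  | cast j =>
    induction i using Fin.lastCases with
    | last => simp [mat_apply_of_lt g (Fin.castSucc_lt_last _), (Fin.castSucc_lt_last j).ne']
    | cast i =>
      have h2 := conj_col g (Pi.single j 1)
      rw [← h, mul_inv_cancel_right] at h2
      have h3 := congrFun (col_injective h2) i
      simp only [Pi.single_apply, mul_ite, mul_one, mul_zero, Finset.sum_ite_eq',
        Finset.mem_univ, if_true, eq_div_iff hg] at h3
      rw [← h3]
      simp [one_apply, mul_comm]

end Algebra

section Topology

variable {n k : ℕ} {F : Subfield ℂ}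

theorem tendsto_nhds_iff {α : Type*} {l : Filter α} {u : α → STP n F} {g : STP n F} :
    Tendsto u l (𝓝 g) ↔
      ∀ i j, Tendsto (fun x => ((mat (u x) i j : F) : ℂ)) l (𝓝 ((mat g i j : F) : ℂ)) := by
  have h : IsInducing fun g : STP n F => fun i j => ((mat g i j : F) : ℂ) := by
    have h1 : IsInducing (mat : STP n F → Matrix (Fin n) (Fin n) F) :=
      IsInducing.subtypeVal.comp IsInducing.subtypeVal
    have h2 : IsInducing fun (A : Fin n → Fin n → F) i j => (A i j : ℂ) :=
      IsInducing.piMap fun _ => IsInducing.piMap fun _ => IsInducing.subtypeVal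
    exact h2.comp h1
  rw [h.tendsto_nhds_iff]
  simp only [tendsto_pi_nhds, Function.comp_def]

theorem continuous_mat_apply (i j : Fin n) :
    Continuous fun g : STP n F => ((mat g i j : F) : ℂ) :=
  continuous_iff_continuousAt.2 fun _ => tendsto_nhds_iff.1 tendsto_id i j

instance isTopologicalGroup : IsTopologicalGroup (STP n F) := by
  have h : IsTopologicalGroup (Matrix.SpecialLinearGroup (Fin n) F) :=
    Matrix.SpecialLinearGroup.topologicalGroup
  infer_instance

theorem tendsto_col {α : Type*} {l : Filter α} {v : α → Fin k → F}
    (h : ∀ i, Tendsto (fun x => (v x i : ℂ)) l (𝓝 0)) :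
    Tendsto (fun x => (col (v x) : STP (k + 1) F)) l (𝓝 1) := by
  rw [tendsto_nhds_iff]
  intro i j
  rw [map_one]
  induction i using Fin.lastCases with
  | last => simpa [mat_col, vecMulVec_apply] using tendsto_const_nhds
  | cast i =>
    have := ((h i).mul_const ((Pi.single (Fin.last k) (1 : F) : Fin (k + 1) → F) j : ℂ)).const_add
      ((1 : Matrix (Fin (k + 1)) (Fin (k + 1)) F) i.castSucc j : ℂ)
    simpa [mat_col, vecMulVec_apply] using this

theorem tendsto_cornerScaling :
    Tendsto (fun t : Fˣ => (cornerScaling t : STP (k + 2) F))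
      (comap (fun t : Fˣ => ((t : F) : ℂ)) (𝓝 1)) (𝓝 1) := by
  have ht : Tendsto (fun t : Fˣ => ((t : F) : ℂ)) (comap (fun t : Fˣ => ((t : F) : ℂ)) (𝓝 1))
    (𝓝 1) := tendsto_comap
  rw [tendsto_nhds_iff]
  intro i j
  by_cases h : i = j
  · subst h
    simp only [cornerScaling, mat_diag, diagonal_apply_eq, map_one, one_apply_eq]
    induction i using Fin.lastCases with
    | last => simpa using ht.inv₀ one_ne_zero
    | cast i =>
      induction i using Fin.cases with
      | zero => simpa using ht
      | succ i =>
        simp only [Fin.snoc_castSucc, Fin.cons_succ, OneMemClass.coe_one]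
        exact tendsto_const_nhds
  · simpa [cornerScaling, h] using tendsto_const_nhds

variable {H : Type*} [Group H] [TopologicalSpace H] [IsTopologicalGroup H] [T2Space H]

theorem exists_nhds_one_norm_lt {φ : STP (k + 2) F →* H} (hφ : Continuous φ)
    (h1 : φ (col (Pi.single 0 1)) ≠ 1) :
    ∃ R : ℝ, 0 < R ∧ ∃ V ∈ 𝓝 (1 : H), ∀ b : F, φ (col (Pi.single 0 b)) ∈ V → ‖(b : ℂ)‖ < R := by
  have hc : Tendsto (fun p : H × H × H => (p.1 * p.2.1 * p.1⁻¹) * (p.2.2 * p.2.1 * p.2.2⁻¹)⁻¹)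
      (𝓝 1 ×ˢ 𝓝 1 ×ˢ 𝓝 1) (𝓝 1) := by
    have : Continuous fun p : H × H × H =>
      (p.1 * p.2.1 * p.1⁻¹) * (p.2.2 * p.2.1 * p.2.2⁻¹)⁻¹ := by fun_prop
    have := this.tendsto (1, 1, 1)
    simpa [nhds_prod_eq] using this
  have hV := hc.eventually (isOpen_ne.mem_nhds h1.symm)
  obtain ⟨V, hV1, hV2⟩ : ∃ V ∈ 𝓝 (1 : H), ∀ x ∈ V, ∀ w ∈ V, ∀ y ∈ V,
      (x * w * x⁻¹) * (y * w * y⁻¹)⁻¹ ≠ φ (col (Pi.single 0 1)) := by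
    rw [eventually_prod_iff] at hV
    obtain ⟨p, hp, q, hq, hpq⟩ := hV
    rw [eventually_prod_iff] at hq
    obtain ⟨q1, hq1, q2, hq2, hq⟩ := hq
    exact ⟨_, inter_mem hp (inter_mem hq1 hq2), fun x hx w hw y hy =>
      hpq hx.1 (hq hw.2.1 hy.2.2)⟩
  have h2 : ∀ᶠ t : Fˣ in comap (fun t : Fˣ => ((t : F) : ℂ)) (𝓝 1),
      φ (cornerScaling t) ∈ V := by
    have := (hφ.tendsto 1).comp (tendsto_cornerScaling (F := F) (k := k))
    rw [map_one] at this
    exact this hV1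
  rw [eventually_comap, Metric.eventually_nhds_iff] at h2
  obtain ⟨r, hr, h2⟩ := h2
  have h3 : ∀ t : F, ‖(t : ℂ)‖ < min r 1 → ∃ u : Fˣ, (u : F) = 1 + t ∧ φ (cornerScaling u) ∈ V := by
    intro t ht
    have ht0 : 1 + t ≠ 0 := by
      intro h
      have : (t : ℂ) = -1 := by
        have := congrArg (Subtype.val) (eq_neg_of_add_eq_zero_right h)
        simpa using this
      rw [this, norm_neg, norm_one] at ht
      exact absurd (ht.trans_le (min_le_right _ _)) (lt_irrefl _)
    refine ⟨Units.mk0 _ ht0, rfl, h2 ?_ _ rfl⟩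
    simpa using ht.trans_le (min_le_left _ _)
  have hr' : 0 < min r 1 := lt_min hr one_pos
  refine ⟨(min r 1)⁻¹, inv_pos.2 hr', V, hV1, fun w hw => ?_⟩
  by_contra! hlt
  have hw0 : w ≠ 0 := by
    rintro rfl
    simp at hlt
    exact absurd hlt (by simpa using hr)
  set δ : F := (4 * w)⁻¹ with hδ
  have hδn : ‖(δ : ℂ)‖ < min r 1 := by
    have h5 : ‖(w : ℂ)‖⁻¹ ≤ min r 1 := inv_le_of_inv_le₀ hr' hlt
    have h6 : 0 < ‖(w : ℂ)‖⁻¹ := inv_pos.2 (by simpa using hw0)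
    have h7 : ‖(δ : ℂ)‖ = ‖(w : ℂ)‖⁻¹ * (4 : ℝ)⁻¹ := by
      have : ‖((4 : F) : ℂ)‖ = 4 := Complex.norm_ofNat 4
      simp [hδ, this]
    rw [h7]
    linarith
  obtain ⟨x, hx, hxV⟩ := h3 δ hδn
  obtain ⟨y, hy, hyV⟩ := h3 (-δ) (by simpa using hδn)
  refine hV2 _ hxV _ hw _ hyV ?_
  simp only [← map_mul, ← map_inv, cornerScaling_conj, ← col_sub, ← Pi.single_sub]
  congr 3
  rw [hx, hy, hδ]
  field_simp
  ring

/-- A group topology coarser than the usual one that separates `1` from a corner element induces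
the usual topology on the corner subgroup. -/
theorem tendsto_of_tendsto_corner {φ : STP (k + 2) F →* H} (hφ : Continuous φ)
    (h1 : φ (col (Pi.single 0 1)) ≠ 1) {α : Type*} {l : Filter α} {b : α → F}
    (hb : Tendsto (fun x => φ (col (Pi.single 0 (b x)))) l (𝓝 1)) :
    Tendsto (fun x => (b x : ℂ)) l (𝓝 0) := by
  obtain ⟨R, hR, V, hV, h⟩ := exists_nhds_one_norm_lt hφ h1
  rw [Metric.tendsto_nhds]
  intro ε hε
  obtain ⟨N, hN⟩ := exists_nat_gt (R / ε)
  have hN0 : 0 < N := by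
    exact_mod_cast (div_pos hR hε).trans hN
  have hNF : (N : F) ≠ 0 := by exact_mod_cast hN0.ne'
  set t : Fˣ := Units.mk0 (N : F) hNF
  have h2 : Tendsto (fun x => φ (cornerScaling t) * φ (col (Pi.single 0 (b x)))
      * (φ (cornerScaling t))⁻¹) l (𝓝 1) := by
    simpa using (hb.const_mul (φ (cornerScaling t))).mul_const (φ (cornerScaling t))⁻¹
  filter_upwards [h2 hV] with x hx
  simp only [Set.mem_preimage, ← map_mul, ← map_inv, cornerScaling_conj] at hx
  have h3 := h _ hx
  have h4 : ‖(((t : F) ^ 2 * b x : F) : ℂ)‖ = (N : ℝ) ^ 2 * ‖(b x : ℂ)‖ := by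
    simp [t]
  rw [h4] at h3
  have h5 : R < N * ε := (div_lt_iff₀ hε).1 hN
  have h6 : (1 : ℝ) ≤ N := by exact_mod_cast hN0
  rw [dist_zero_right]
  by_contra! h7
  nlinarith [mul_le_mul_of_nonneg_left h7 (sq_nonneg (N : ℝ)), mul_pos hε (one_pos.trans_le h6)]

theorem tendsto_of_tendsto_col {φ : STP (k + 2) F →* H} (hφ : Continuous φ)
    (h1 : φ (col (Pi.single 0 1)) ≠ 1) {α : Type*} {l : Filter α} {v : α → Fin (k + 1) → F}
    (hv : Tendsto (fun x => φ (col (v x))) l (𝓝 1)) (i : Fin (k + 1)) :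
    Tendsto (fun x => (v x i : ℂ)) l (𝓝 0) := by
  have hs : ∀ j : Fin k, Tendsto (fun x => (v x j.succ : ℂ)) l (𝓝 0) := by
    intro j
    apply tendsto_of_tendsto_corner hφ h1
    have hc := ((hv.const_mul (φ (addRow j))).mul_const (φ (addRow j))⁻¹).mul hv.inv
    rw [mul_one, mul_inv_cancel, inv_one, mul_one] at hc
    refine hc.congr fun x => ?_
    rw [← map_inv, ← map_mul, ← map_mul, ← map_inv, ← map_mul, commutator_addRow]
  induction i using Fin.cases with
  | succ j => exact hs j
  | zero =>
    apply tendsto_of_tendsto_corner hφ h1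
    have hw : Tendsto (fun x => col (v x - Pi.single 0 (v x 0))) l (𝓝 1) := by
      apply tendsto_col
      intro i
      induction i using Fin.cases with
      | zero => simpa using tendsto_const_nhds
      | succ j => simpa using hs j
    have hc := ((hφ.tendsto _).comp hw).inv.mul hv
    rw [map_one, inv_one, one_mul] at hc
    refine hc.congr fun x => ?_
    rw [Function.comp_apply, ← map_inv, ← map_mul, ← col_neg, ← col_add]
    congr 2
    abel

theorem tendsto_mat_div_lastEntry {φ : STP (k + 2) F →* H} (hφ : Continuous φ)
    (h1 : φ (col (Pi.single 0 1)) ≠ 1) {α : Type*} {l : Filter α} {u : α → STP (k + 2) F}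
    (hu : Tendsto (fun x => φ (u x)) l (𝓝 1)) (i j : Fin (k + 2)) :
    Tendsto (fun x => ((mat (u x) i j / lastEntry (u x) : F) : ℂ)) l
      (𝓝 ((1 : Matrix (Fin (k + 2)) (Fin (k + 2)) ℂ) i j)) := by
  have hconj : ∀ y : STP (k + 2) F,
      Tendsto (fun x => φ (u x * y * (u x)⁻¹ * y⁻¹)) l (𝓝 1) := by
    intro y
    simp only [map_mul, map_inv]
    simpa using ((hu.mul_const (φ y)).mul hu.inv).mul_const (φ y)⁻¹
  induction i using Fin.lastCases with
  | last =>
    induction j using Fin.lastCases with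
    | last =>
      refine tendsto_const_nhds.congr fun x => ?_
      rw [← lastEntry_apply, div_self (lastEntry_ne_zero (u x)), one_apply_eq]
      rfl
    | cast j =>
      simp only [mat_apply_of_lt _ (Fin.castSucc_lt_last j), zero_div,
        one_apply_ne (Fin.castSucc_lt_last j).ne']
      exact tendsto_const_nhds
  | cast i =>
    induction j using Fin.lastCases with
    | last =>
      have h2 := hconj (almostScalar (Units.mk0 2 two_ne_zero))
      simp only [commutator_almostScalar] at h2
      have h3 := tendsto_of_tendsto_col hφ h1 h2 i
      have h4 : (1 - 2 ^ (k + 2) : ℂ) ≠ 0 := by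
        rw [sub_ne_zero]
        exact_mod_cast (Nat.one_lt_two_pow (Nat.succ_ne_zero _)).ne
      have h5 := h3.const_mul (1 - 2 ^ (k + 2) : ℂ)⁻¹
      rw [mul_zero] at h5
      rw [one_apply_ne (Fin.castSucc_lt_last i).ne]
      refine h5.congr fun x => ?_
      have h6 : (((1 - (2 : F) ^ (k + 2)) : F) : ℂ) = 1 - 2 ^ (k + 2) := by
        push_cast
        rfl
      rw [Units.val_mk0, Subfield.coe_mul, h6, inv_mul_cancel_left₀ h4]
    | cast j =>
      have h2 := hconj (col (Pi.single j 1))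
      simp only [conj_col, ← col_sub] at h2
      have h3 := (tendsto_of_tendsto_col hφ h1 h2 i).add_const
        ((1 : Matrix (Fin (k + 2)) (Fin (k + 2)) ℂ) i.castSucc j.castSucc)
      rw [zero_add] at h3
      refine h3.congr fun x => ?_
      by_cases h : i = j <;> simp [Pi.single_apply, one_apply, h]

/-- Along an ultrafilter converging to `1` in a coarser group topology that separates `1` from a
corner element, matrices converge entrywise to a scalar complex matrix of determinant `1`. -/
theorem exists_tendsto_scalar {φ : STP (k + 2) F →* H} (hφ : Continuous φ)
    (h1 : φ (col (Pi.single 0 1)) ≠ 1) {α : Type*} {l : Ultrafilter α} {u : α → STP (k + 2) F}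
    (hu : Tendsto (fun x => φ (u x)) l (𝓝 1)) :
    ∃ ζ ∈ closure (F : Set ℂ), ζ ^ (k + 2) = 1 ∧ ∀ i j,
      Tendsto (fun x => ((mat (u x) i j : F) : ℂ)) l
        (𝓝 ((ζ • (1 : Matrix (Fin (k + 2)) (Fin (k + 2)) ℂ)) i j)) := by
  have hr := tendsto_mat_div_lastEntry hφ h1 hu
  have hdet : Tendsto (fun x => ((lastEntry (u x) : F) : ℂ) ^ (k + 2)) l (𝓝 1) := by
    have h2 := tendsto_finsetProd Finset.univ fun i _ => hr i i
    simp only [one_apply_eq, Finset.prod_const_one] at h2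
    replace h2 := h2.inv₀ one_ne_zero
    rw [inv_one] at h2
    refine h2.congr fun x => ?_
    have h3 : ∏ i, ((mat (u x) i i : F) : ℂ) = 1 := by
      exact_mod_cast congrArg (Subtype.val) (prod_mat_diag (u x))
    simp [Finset.prod_div_distrib, h3]
  have hb : ∀ᶠ x in l, ((lastEntry (u x) : F) : ℂ) ∈ Metric.closedBall (0 : ℂ) 2 := by
    have h2 := hdet.norm.eventually
      (gt_mem_nhds (by norm_num : ‖(1 : ℂ)‖ < 2))
    filter_upwards [h2] with x hx
    rw [mem_closedBall_zero_iff]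
    rw [norm_pow] at hx
    by_contra! h3
    have := le_self_pow₀ (by linarith : (1 : ℝ) ≤ ‖((lastEntry (u x) : F) : ℂ)‖)
      (by omega : k + 2 ≠ 0)
    linarith
  obtain ⟨ζ, -, hζ⟩ := (isCompact_closedBall (0 : ℂ) 2).ultrafilter_le_nhds
    (l.map fun x => ((lastEntry (u x) : F) : ℂ)) (le_principal_iff.2 hb)
  have hζ' : Tendsto (fun x => ((lastEntry (u x) : F) : ℂ)) l (𝓝 ζ) := hζ
  refine ⟨ζ, mem_closure_of_tendsto hζ' (Eventually.of_forall fun x => (lastEntry (u x)).2),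
    tendsto_nhds_unique (hζ'.pow _) hdet, fun i j => ?_⟩
  refine (hζ'.mul (hr i j)).congr fun x => ?_
  have : ((lastEntry (u x) : F) : ℂ) ≠ 0 := by simpa using lastEntry_ne_zero (u x)
  rw [Subfield.coe_div, mul_div_cancel₀ _ this]

end Topology

end STP

section Minimal

universe u

theorem IsMinimal.isInducing {G : Type*} [Group G] [TopologicalSpace G] (hG : IsMinimal G)
    {H : Type*} [Group H] [TopologicalSpace H] [IsTopologicalGroup H] [T2Space H] {φ : G →* H}
    (hφ : Continuous φ) (hinj : Function.Injective φ) : IsInducing φ := by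
  refine ⟨(hG ⟨TopologicalSpace.induced φ ‹_›, topologicalGroup_induced φ⟩
    (continuous_iff_le_induced.1 hφ) ?_).symm⟩
  let : TopologicalSpace G := TopologicalSpace.induced φ ‹_›
  exact T2Space.of_injective_continuous hinj continuous_induced_dom

theorem isMinimal_of_forall_isInducing {G : Type u} [Group G] [τ : TopologicalSpace G]
    (h : ∀ (H : Type u) [Group H] [TopologicalSpace H] [IsTopologicalGroup H] [T2Space H]
      (φ : G →* H), Continuous φ → Function.Injective φ → IsInducing φ) : IsMinimal G := by
  intro σ hσ hT2
  have := @IsInducing.eq_induced G G τ σ.toTopologicalSpace _ <|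
    @h G _ σ.toTopologicalSpace σ.toIsTopologicalGroup hT2 (MonoidHom.id G)
      (@continuous_id_iff_le G τ σ.toTopologicalSpace |>.2 hσ) Function.injective_id
  exact (this.trans (@induced_id G σ.toTopologicalSpace)).symm

theorem isInducing_of_forall_ultrafilter {G H : Type*} [Group G] [TopologicalSpace G]
    [IsTopologicalGroup G] [Group H] [TopologicalSpace H] [IsTopologicalGroup H] {φ : G →* H}
    (hφ : Continuous φ)
    (h : ∀ l : Ultrafilter G, Tendsto φ l (𝓝 1) → Tendsto id (l : Filter G) (𝓝 1)) :
    IsInducing φ := by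
  refine ⟨IsTopologicalGroup.ext inferInstance (topologicalGroup_induced φ) ?_⟩
  rw [nhds_induced, map_one]
  refine le_antisymm ?_ (le_iff_ultrafilter.2 fun l hl => h l (tendsto_iff_comap.2 hl))
  rw [← tendsto_iff_comap]
  simpa using hφ.tendsto 1

theorem isMinimal_of_subsingleton {G : Type*} [Group G] [TopologicalSpace G] [Subsingleton G] :
    IsMinimal G := fun _ _ _ => Subsingleton.elim _ _

end Minimal

namespace STP

section Minimal

variable {k : ℕ} {F : Subfield ℂ}

theorem corner_notMem_center :
    (col (Pi.single 0 1) : STP (k + 2) F) ∉ Subgroup.center (STP (k + 2) F) := by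
  intro h
  have := congrFun (congrFun (mat_eq_smul_one_of_mem_center h) (Fin.castSucc 0)) (Fin.last _)
  rw [Matrix.smul_apply, one_apply_ne (Fin.castSucc_lt_last _).ne] at this
  simp [mat_col, vecMulVec_apply] at this

theorem corner_ne_one : (col (Pi.single 0 1) : STP (k + 2) F) ≠ 1 := fun h =>
  corner_notMem_center (h ▸ Subgroup.one_mem _)

/-- The scalar matrix given by an `n`-th root of unity. -/
noncomputable def scalar (z : F) (hz : z ^ (k + 2) = 1) : STP (k + 2) F :=
  diag (fun _ => z) (by simpa using hz)

theorem mat_scalar (z : F) (hz : z ^ (k + 2) = 1) : mat (scalar z hz) = z • 1 := by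
  rw [scalar, mat_diag, smul_one_eq_diagonal]

theorem tendsto_scalar {α : Type*} {l : Filter α} {u : α → STP (k + 2) F} {z : F}
    (hz : z ^ (k + 2) = 1)
    (h : ∀ i j, Tendsto (fun x => ((mat (u x) i j : F) : ℂ)) l
      (𝓝 (((z : ℂ) • (1 : Matrix (Fin (k + 2)) (Fin (k + 2)) ℂ)) i j))) :
    Tendsto u l (𝓝 (scalar z hz)) := by
  rw [tendsto_nhds_iff]
  intro i j
  convert h i j using 2
  rw [mat_scalar]
  by_cases hij : i = j <;> simp [hij]

theorem isMinimal (hF : ∀ p, p.Prime → p ∣ k + 2 → ∀ ζ ∈ closure (F : Set ℂ), ζ ^ p = 1 → ζ ∈ F) :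
    IsMinimal (STP (k + 2) F) := by
  refine isMinimal_of_forall_isInducing fun H _ _ _ _ φ hφ hinj => ?_
  have h1 : φ (col (Pi.single 0 1)) ≠ 1 := by
    rw [← map_one φ]
    exact hinj.ne corner_ne_one
  refine isInducing_of_forall_ultrafilter hφ fun l hl => ?_
  obtain ⟨ζ, hζF, hζ, hl2⟩ := exists_tendsto_scalar hφ h1 (u := id) hl
  have key : ∀ m, ζ ^ m ∈ F → ζ ^ m = 1 := by
    intro m hm
    have hlm : Tendsto (fun g => φ (g ^ m)) l (𝓝 1) := by
      simpa using hl.pow m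
    obtain ⟨ξ, -, -, hl3⟩ := exists_tendsto_scalar hφ h1 hlm
    have hz : (⟨ζ ^ m, hm⟩ : F) ^ (k + 2) = 1 := Subtype.ext <| by
      simp [← pow_mul, mul_comm m, pow_mul ζ, hζ]
    have hξ : ξ = ζ ^ m := by
      have e1 := hl3 (Fin.last _) (Fin.last _)
      have e2 := (hl2 (Fin.last _) (Fin.last _)).pow m
      simp only [← lastEntry_apply, map_pow, SubmonoidClass.coe_pow, Matrix.smul_apply,
        one_apply_eq, smul_eq_mul, mul_one, id_eq] at e1 e2
      exact tendsto_nhds_unique e1 e2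
    subst hξ
    have h2 : Tendsto (fun g => φ (g ^ m)) l (𝓝 (φ (scalar _ hz))) :=
      (hφ.tendsto _).comp (tendsto_scalar hz hl3)
    have h3 : scalar _ hz = 1 := hinj ((tendsto_nhds_unique h2 hlm).trans (map_one φ).symm)
    have h4 := congrArg lastEntry h3
    rw [lastEntry_apply, mat_scalar, map_one] at h4
    simpa using congrArg ((↑) : F → ℂ) h4
  have hζ1 : ζ = 1 := by
    by_contra hne
    have hd : orderOf ζ ≠ 1 := by simpa using hne
    have hdn : orderOf ζ ∣ k + 2 := orderOf_dvd_of_pow_eq_one hζ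
    obtain ⟨p, hp, hpd⟩ := Nat.exists_prime_and_dvd hd
    obtain ⟨m, hm⟩ := hpd
    have hpos : 0 < orderOf ζ := Nat.pos_of_dvd_of_pos hdn (by omega)
    have hmem : ζ ^ m ∈ F := by
      refine hF p hp ((Dvd.intro _ hm.symm).trans hdn) _ ?_ ?_
      · have : ζ ^ m ∈ F.topologicalClosure := pow_mem (show ζ ∈ F.topologicalClosure from hζF) m
        exact this
      · rw [← pow_mul, mul_comm, ← hm, pow_orderOf_eq_one]
    have hm0 : 0 < m := Nat.pos_of_ne_zero fun h0 => by simp [hm, h0] at hpos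
    have := Nat.le_of_dvd hm0 (orderOf_dvd_of_pow_eq_one (key m hmem))
    nlinarith [hp.two_le]
  subst hζ1
  have := tendsto_scalar (u := id) (z := 1) (one_pow _) hl2
  convert this using 2
  apply mat_injective
  rw [mat_scalar, one_smul, map_one]

theorem isMinimal_quotient_center
    (hF : ∀ ζ ∈ closure (F : Set ℂ), ζ ^ (k + 2) = 1 → ζ ∈ F) :
    IsMinimal (STP (k + 2) F ⧸ Subgroup.center (STP (k + 2) F)) := by
  refine isMinimal_of_forall_isInducing fun H _ _ _ _ φ hφ hinj => ?_
  set π := QuotientGroup.mk' (Subgroup.center (STP (k + 2) F))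
  have hπ : Continuous π := continuous_quotient_mk'
  have hφπ : Continuous (φ.comp π) := hφ.comp hπ
  have h1 : φ.comp π (col (Pi.single 0 1)) ≠ 1 := by
    rw [← map_one φ]
    refine hinj.ne fun h => corner_notMem_center ((QuotientGroup.eq_one_iff _).1 h)
  refine isInducing_of_forall_ultrafilter hφ fun l hl => ?_
  have hout : ∀ x, π (Quotient.out x) = x := fun x => Quotient.out_eq x
  obtain ⟨ζ, hζF, hζ, hl2⟩ := exists_tendsto_scalar hφπ h1 (l := l) (u := Quotient.out)
    (by simpa [hout] using hl)
  have hz : (⟨ζ, hF ζ hζF hζ⟩ : F) ^ (k + 2) = 1 := Subtype.ext hζ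
  have h2 := (hπ.tendsto _).comp (tendsto_scalar hz hl2)
  have h3 : π (scalar _ hz) = 1 :=
    (QuotientGroup.eq_one_iff _).2 (mem_center_of_mat_eq_smul_one (mat_scalar _ hz))
  rw [h3] at h2
  exact h2.congr hout

end Minimal

section Representation

variable {k m : ℕ} {F : Subfield ℂ}

/-- The normalised matrix `g / g_{nn}`, together with `g_{nn} ^ m`. -/
noncomputable def projRep (m : ℕ) :
    STP (k + 1) F →* Matrix (Fin (k + 1)) (Fin (k + 1)) ℂ × ℂ where
  toFun g := (((lastEntry g : F) : ℂ)⁻¹ • (mat g).map F.subtype, ((lastEntry g : F) : ℂ) ^ m)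
  map_one' := by ext <;> simp
  map_mul' g h := by
    simp only [map_mul, Subfield.coe_mul, mul_inv, mul_pow, Matrix.map_mul, Prod.mk_mul_mk,
      smul_mul_smul_comm]

theorem projRep_fst (g : STP (k + 1) F) (i j : Fin (k + 1)) :
    (projRep m g).1 i j = ((lastEntry g : F) : ℂ)⁻¹ * (mat g i j : F) := rfl

theorem projRep_snd (g : STP (k + 1) F) : (projRep m g).2 = ((lastEntry g : F) : ℂ) ^ m := rfl

theorem projRep_eq_one {g : STP (k + 1) F} (h : mat g = lastEntry g • 1)
    (hm : lastEntry g ^ m = 1) : projRep m g = 1 := by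
  have hg : ((lastEntry g : F) : ℂ) ≠ 0 := by simpa using lastEntry_ne_zero g
  refine Prod.ext (Matrix.ext fun i j => ?_) ?_
  · rw [projRep_fst, h]
    by_cases hij : i = j <;> simp [hij, hg]
  · simpa [projRep_snd] using congrArg ((↑) : F → ℂ) hm

theorem mat_eq_smul_one_of_projRep_eq_one {g : STP (k + 1) F} (h : projRep m g = 1) :
    mat g = lastEntry g • 1 := by
  have hg : ((lastEntry g : F) : ℂ) ≠ 0 := by simpa using lastEntry_ne_zero g
  ext i j
  have := congrArg (fun x => x.1 i j) h
  simp only [projRep_fst, Prod.fst_one] at this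
  rw [inv_mul_eq_iff_eq_mul₀ hg] at this
  rw [this]
  obtain rfl | hij := eq_or_ne i j <;> simp [*]

theorem lastEntry_pow_of_projRep_eq_one {g : STP (k + 1) F} (h : projRep m g = 1) :
    lastEntry g ^ m = 1 := by
  have := congrArg Prod.snd h
  rw [projRep_snd] at this
  exact Subtype.ext (by simpa using this)

theorem continuous_projRep : Continuous (projRep m : STP (k + 1) F → _) := by
  have h : Continuous fun g : STP (k + 1) F => ((lastEntry g : F) : ℂ) := continuous_mat_apply _ _
  refine .prodMk (continuous_matrix fun i j => ?_) (h.pow m)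
  exact (h.inv₀ fun g => by simpa using lastEntry_ne_zero g).mul (continuous_mat_apply i j)

theorem continuous_toHomUnits_projRep :
    Continuous (projRep m : STP (k + 1) F →* _).toHomUnits := by
  refine Units.continuous_iff.2 ⟨continuous_projRep, ?_⟩
  have : Continuous fun g : STP (k + 1) F => projRep m g⁻¹ := continuous_projRep.comp continuous_inv
  refine this.congr fun g => ?_
  rw [← MonoidHom.coe_toHomUnits, map_inv]

theorem tendsto_projRep_almostScalar {α : Type*} {l : Filter α} {t : α → Fˣ} {ζ : ℂ}
    (hζ : ζ ^ m = 1) (hm : m ∣ k + 1) (ht : Tendsto (fun x => ((t x : F) : ℂ)) l (𝓝 ζ)) :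
    Tendsto (fun x => projRep m (almostScalar (t x) : STP (k + 1) F)) l (𝓝 1) := by
  have hζk : ζ ^ (k + 1) = 1 := by
    obtain ⟨c, hc⟩ := hm
    rw [hc, pow_mul, hζ, one_pow]
  have h0 : ζ ≠ 0 := by
    rintro rfl
    simp at hζk
  have hlast : Tendsto (fun x => ((lastEntry (almostScalar (t x) : STP (k + 1) F) : F) : ℂ)) l
      (𝓝 ζ) := by
    convert (ht.inv₀ h0).pow k using 2
    · simp [lastEntry_apply, mat_almostScalar]
    · exact eq_inv_of_mul_eq_one_right hζk |>.trans (inv_pow _ _).symm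
  rw [Prod.tendsto_iff]
  constructor
  · refine tendsto_pi_nhds.2 fun i => tendsto_pi_nhds.2 fun j => ?_
    simp only [projRep_fst]
    by_cases hij : i = j
    · subst hij
      have : Tendsto (fun x => ((mat (almostScalar (t x) : STP (k + 1) F) i i : F) : ℂ)) l
          (𝓝 ζ) := by
        induction i using Fin.lastCases with
        | last => exact hlast
        | cast i => simpa [mat_almostScalar] using ht
      simpa [h0] using (hlast.inv₀ h0).mul this
    · simpa [mat_almostScalar, hij] using tendsto_const_nhds
  · simpa [projRep_snd, hζ] using hlast.pow m

theorem tendsto_toHomUnits_projRep_almostScalar {α : Type*} {l : Filter α} {t : α → Fˣ} {ζ : ℂ}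
    (hζ : ζ ^ m = 1) (hm : m ∣ k + 1) (ht : Tendsto (fun x => ((t x : F) : ℂ)) l (𝓝 ζ)) :
    Tendsto (fun x => (projRep m).toHomUnits (almostScalar (t x) : STP (k + 1) F)) l (𝓝 1) := by
  have h0 : ζ ≠ 0 := by
    rintro rfl
    rcases m with _ | m
    · simp at hm
    · simp at hζ
  rw [Units.isInducing_embedProduct.tendsto_nhds_iff, map_one, Prod.tendsto_iff]
  refine ⟨tendsto_projRep_almostScalar hζ hm ht, MulOpposite.continuous_op.continuousAt.tendsto.comp
    ((tendsto_projRep_almostScalar (t := fun x => (t x)⁻¹) (ζ := ζ⁻¹) ?_ hm ?_).congr fun x => ?_)⟩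
  · rw [inv_pow, hζ, inv_one]
  · simpa using ht.inv₀ h0
  · rw [almostScalar_inv, ← MonoidHom.coe_toHomUnits, map_inv]

theorem exists_tendsto_units {ζ : ℂ} (hζ : ζ ∈ closure (F : Set ℂ)) (h0 : ζ ≠ 0) :
    ∃ (l : Filter Fˣ), l.NeBot ∧ Tendsto (fun t : Fˣ => ((t : F) : ℂ)) l (𝓝 ζ) := by
  refine ⟨comap (fun t : Fˣ => ((t : F) : ℂ)) (𝓝 ζ), comap_neBot_iff.2 fun s hs => ?_,
    tendsto_comap⟩
  obtain ⟨x, ⟨hxs, hx0⟩, hxF⟩ :=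
    mem_closure_iff_nhds.1 hζ _ (inter_mem hs (isOpen_ne.mem_nhds h0))
  exact ⟨Units.mk0 ⟨x, hxF⟩ fun h => hx0 (congrArg Subtype.val h), hxs⟩

theorem mem_of_isMinimal (hmin : IsMinimal (STP (k + 2) F)) {p : ℕ} (hp : p.Prime)
    (hpk : p ∣ k + 2) {ζ : ℂ} (hζF : ζ ∈ closure (F : Set ℂ)) (hζ : ζ ^ p = 1) : ζ ∈ F := by
  have : Fact p.Prime := ⟨hp⟩
  by_contra hnot
  have hne : ζ ≠ 1 := fun h => hnot (h ▸ F.one_mem)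
  have h0 : ζ ≠ 0 := by
    rintro rfl
    simp [hp.ne_zero] at hζ
  have hinj : Function.Injective (projRep p : STP (k + 2) F →* _).toHomUnits := by
    refine (injective_iff_map_eq_one _).2 fun g hg => ?_
    have hg1 : projRep p g = 1 := by rw [← MonoidHom.coe_toHomUnits, hg, Units.val_one]
    have hgp := lastEntry_pow_of_projRep_eq_one hg1
    have hmat := mat_eq_smul_one_of_projRep_eq_one hg1
    suffices h : lastEntry g = 1 by
      apply mat_injective
      rw [hmat, h, one_smul, map_one]
    by_contra hη
    have hη1 : ((lastEntry g : F) : ℂ) ≠ 1 := fun h => hη (Subtype.ext h)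
    have hprim : IsPrimitiveRoot ((lastEntry g : F) : ℂ) p := by
      have := orderOf_eq_prime (p := p) (x := ((lastEntry g : F) : ℂ)) (by exact_mod_cast hgp) hη1
      exact this ▸ IsPrimitiveRoot.orderOf _
    obtain ⟨i, -, hi⟩ := hprim.eq_pow_of_pow_eq_one hζ
    exact hnot (hi ▸ F.pow_mem (lastEntry g).2 i)
  obtain ⟨l, _, hl⟩ := exists_tendsto_units hζF h0
  have h1 := tendsto_toHomUnits_projRep_almostScalar (k := k + 1) hζ hpk hl
  have h2 := (hmin.isInducing continuous_toHomUnits_projRep hinj).tendsto_nhds_iff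
    (f := fun t : Fˣ => almostScalar t) (y := 1) (l := l)
  rw [map_one] at h2
  have h3 := tendsto_nhds_iff.1 (h2.2 h1) (Fin.castSucc 0) (Fin.castSucc 0)
  simp only [mat_almostScalar, diagonal_apply_eq, Fin.snoc_castSucc, map_one, one_apply_eq] at h3
  exact hne (tendsto_nhds_unique hl h3)

theorem mem_of_isMinimal_quotient_center
    (hmin : IsMinimal (STP (k + 2) F ⧸ Subgroup.center (STP (k + 2) F))) {ζ : ℂ}
    (hζF : ζ ∈ closure (F : Set ℂ)) (hζ : ζ ^ (k + 2) = 1) : ζ ∈ F := by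
  by_contra hnot
  have h0 : ζ ≠ 0 := by
    rintro rfl
    simp at hζ
  set ψ : STP (k + 2) F →* _ := (projRep (k + 2)).toHomUnits
  have hψ : ∀ g ∈ Subgroup.center (STP (k + 2) F), ψ g = 1 := by
    intro g hg
    have hmat := mat_eq_smul_one_of_mem_center hg
    have hpow : lastEntry g ^ (k + 2) = 1 := by
      rw [← prod_mat_diag g, hmat]
      simp
    exact Units.ext (projRep_eq_one hmat hpow)
  have hinj : Function.Injective (QuotientGroup.lift _ ψ hψ) := by
    refine (injective_iff_map_eq_one _).2 fun x hx => ?_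
    obtain ⟨g, rfl⟩ := QuotientGroup.mk_surjective x
    have hg : projRep (k + 2) g = 1 := congrArg Units.val hx
    exact (QuotientGroup.eq_one_iff _).2
      (mem_center_of_mat_eq_smul_one (mat_eq_smul_one_of_projRep_eq_one hg))
  have hcont : Continuous (QuotientGroup.lift _ ψ hψ) :=
    continuous_toHomUnits_projRep.quotient_lift _
  obtain ⟨l, _, hl⟩ := exists_tendsto_units hζF h0
  have h1 := tendsto_toHomUnits_projRep_almostScalar (k := k + 1) hζ dvd_rfl hl
  have h2 := (hmin.isInducing hcont hinj).tendsto_nhds_iff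
    (f := fun t : Fˣ => ((almostScalar t : STP (k + 2) F) : _ ⧸ Subgroup.center _))
    (y := 1) (l := l)
  rw [map_one] at h2
  have h3 := h2.2 h1
  set R : Set ℂ := {η | η ∈ F ∧ η ^ (k + 2) = 1}
  have hR : R.Finite := by
    refine (Polynomial.nthRootsFinset (k + 2) (1 : ℂ)).finite_toSet.subset fun η hη => ?_
    exact (Polynomial.mem_nthRootsFinset (by omega) _).2 hη.2
  suffices ζ ∈ closure R from hnot (hR.isClosed.closure_eq ▸ this).1
  refine Metric.mem_closure_iff.2 fun ε hε => ?_
  have hV : ∀ᶠ g in 𝓝 (1 : STP (k + 2) F), dist ((mat g 0 0 : F) : ℂ) 1 < ε / 2 := by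
    have := (continuous_mat_apply (n := k + 2) (F := F) 0 0).tendsto 1
    simp only [map_one, one_apply_eq] at this
    exact this.eventually (Metric.ball_mem_nhds _ (half_pos hε))
  have hπV := (QuotientGroup.isOpenMap_coe
    (N := Subgroup.center (STP (k + 2) F))).image_mem_nhds hV
  obtain ⟨t, ⟨v, hv, hvt⟩, ht⟩ :=
    ((h3.eventually hπV).and (hl.eventually (Metric.ball_mem_nhds _ (half_pos hε)))).exists
  have hc := QuotientGroup.eq.1 hvt
  have hmat := mat_eq_smul_one_of_mem_center hc
  set η := lastEntry (v⁻¹ * almostScalar t)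
  have hη : η ^ (k + 2) = 1 := by
    rw [← prod_mat_diag (v⁻¹ * almostScalar t), hmat]
    simp
  have htv : (t : F) = mat v 0 0 * η := by
    have := congrFun (congrFun (map_mul mat v (v⁻¹ * almostScalar t)) 0) 0
    rw [mul_inv_cancel_left, hmat, mat_almostScalar] at this
    simpa [mul_comm] using this
  have hη' : (η : ℂ) ^ (k + 2) = 1 := by exact_mod_cast congrArg ((↑) : F → ℂ) hη
  refine ⟨η, ⟨η.2, hη'⟩, ?_⟩
  have h4 : dist ((t : F) : ℂ) η < ε / 2 := by
    rw [htv, Subfield.coe_mul, dist_eq_norm, ← sub_one_mul, norm_mul,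
      Complex.norm_eq_one_of_pow_eq_one hη' (by omega), mul_one]
    simpa [dist_eq_norm] using hv
  have h5 : dist ((t : F) : ℂ) ζ < ε / 2 := ht
  linarith [dist_triangle_left ζ (η : ℂ) ((t : F) : ℂ)]

end Representation

end STP

section RootsOfUnity

theorem mem_subfield_of_pow_mem_of_coprime {K : Type*} [Field K] {F : Subfield K} {x : K}
    {a b : ℕ} (hab : a.Coprime b) (ha : x ^ a ∈ F) (hb : x ^ b ∈ F) : x ∈ F := by
  rcases eq_or_ne x 0 with rfl | hx
  · exact F.zero_mem
  have h : x = (x ^ a) ^ a.gcdA b * (x ^ b) ^ a.gcdB b := by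
    rw [← zpow_natCast, ← zpow_natCast, ← _root_.zpow_mul, ← _root_.zpow_mul, ← zpow_add₀ hx,
      ← Nat.gcd_eq_gcd_ab, hab.gcd_eq_one, Nat.cast_one, zpow_one]
  rw [h]
  exact F.mul_mem (F.zpow_mem ha _) (F.zpow_mem hb _)

theorem mem_subfield_of_pow_eq_one_of_squarefree {F : Subfield ℂ} {n : ℕ} (hn : Squarefree n)
    (hF : ∀ p, p.Prime → p ∣ n → ∀ ζ ∈ closure (F : Set ℂ), ζ ^ p = 1 → ζ ∈ F) {ζ : ℂ}
    (hζF : ζ ∈ closure (F : Set ℂ)) (hζ : ζ ^ n = 1) : ζ ∈ F := by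
  induction n using Nat.recOnMul generalizing ζ with
  | zero => exact absurd hn not_squarefree_zero
  | one => exact (pow_one ζ ▸ hζ) ▸ F.one_mem
  | prime p hp => exact hF p hp dvd_rfl ζ hζF hζ
  | mul a b iha ihb =>
    have hcl : ∀ m, ζ ^ m ∈ closure (F : Set ℂ) :=
      fun m => pow_mem (show ζ ∈ F.topologicalClosure from hζF) m
    refine mem_subfield_of_pow_mem_of_coprime (Nat.coprime_of_squarefree_mul hn) ?_ ?_
    · refine ihb hn.of_mul_right (fun p hp hpb => hF p hp (hpb.mul_left a)) (hcl a) ?_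
      rw [← pow_mul, hζ]
    · refine iha hn.of_mul_left (fun p hp hpb => hF p hp (hpb.mul_right b)) (hcl b) ?_
      rw [← pow_mul, mul_comm, hζ]

theorem closure_eq_univ_of_isPrimitiveRoot_three {F : Subfield ℂ} {ω : ℂ}
    (hω : IsPrimitiveRoot ω 3) (hωF : ω ∈ F) : closure (F : Set ℂ) = Set.univ := by
  rcases Complex.subfield_eq_of_closed (K := F.topologicalClosure)
    F.isClosed_topologicalClosure with h | h
  · exfalso
    have : ω ∈ F.topologicalClosure := F.le_topologicalClosure hωF
    rw [h] at this
    obtain ⟨x, rfl⟩ := this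
    have hx : x ^ 3 = 1 := Complex.ofReal_injective (by simpa using hω.pow_eq_one)
    have : x = 1 := by nlinarith [sq_nonneg (x + 1), sq_nonneg x]
    exact hω.ne_one (by norm_num) (by simp [this])
  · exact congrArg ((↑) : Subfield ℂ → Set ℂ) h

theorem IsPrimitiveRoot.prime_mul_notMem_adjoin {M p : ℕ} (hM : M ≠ 0) (hp : p.Prime) (hpM : p ∣ M)
    {ζ ξ : ℂ} (hζ : IsPrimitiveRoot ζ M) (hξ : IsPrimitiveRoot ξ (p * M)) :
    ξ ∉ IntermediateField.adjoin ℚ {ζ} := by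
  intro h
  have hdeg : ∀ {m : ℕ} {x : ℂ}, m ≠ 0 → IsPrimitiveRoot x m →
      (minpoly ℚ x).natDegree = m.totient := fun hm hx => by
    rw [← Polynomial.cyclotomic_eq_minpoly_rat hx (Nat.pos_of_ne_zero hm),
      Polynomial.natDegree_cyclotomic]
  have hint : IsIntegral ℚ ζ := hζ.isIntegral (Nat.pos_of_ne_zero hM) |>.tower_top
  have := IntermediateField.adjoin.finiteDimensional hint
  have h1 : (minpoly ℚ ξ).natDegree ≤ Module.finrank ℚ (IntermediateField.adjoin ℚ {ζ}) := by
    rw [← IntermediateField.minpoly_eq (⟨ξ, h⟩ : IntermediateField.adjoin ℚ {ζ})]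
    exact minpoly.natDegree_le _
  rw [IntermediateField.adjoin.finrank hint, hdeg hM hζ, hdeg (mul_ne_zero hp.ne_zero hM) hξ,
    Nat.totient_mul_of_prime_of_dvd hp hpM] at h1
  nlinarith [hp.two_le, Nat.totient_pos.2 (Nat.pos_of_ne_zero hM)]

theorem exists_pow_prime_sq_eq_one_notMem_adjoin {M p : ℕ} (hM : Squarefree M) (hp : p.Prime)
    (hpM : p ∣ M) {ζ : ℂ} (hζ : IsPrimitiveRoot ζ M) :
    ∃ x : ℂ, x ^ (p * p) = 1 ∧ x ∉ (IntermediateField.adjoin ℚ {ζ}).toSubfield := by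
  by_contra! hcon
  have : NeZero M := ⟨hM.ne_zero⟩
  obtain ⟨c, rfl⟩ := hpM
  have hpc : p.Coprime c := Nat.coprime_of_squarefree_mul hM
  have hξ := Complex.isPrimitiveRoot_exp (p * (p * c)) (mul_ne_zero hp.ne_zero hM.ne_zero)
  set ξ := Complex.exp (2 * Real.pi * Complex.I / (p * (p * c) : ℕ))
  refine IsPrimitiveRoot.prime_mul_notMem_adjoin hM.ne_zero hp (dvd_mul_right p c) hζ hξ ?_
  refine mem_subfield_of_pow_mem_of_coprime
    (F := (IntermediateField.adjoin ℚ {ζ}).toSubfield) (hpc.mul_left hpc).symm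
    (hcon _ ?_) ?_
  · rw [← pow_mul, ← hξ.pow_eq_one]
    ring_nf
  · obtain ⟨i, -, hi⟩ := hζ.eq_pow_of_pow_eq_one (ξ := ξ ^ (p * p)) (by
      rw [← pow_mul, mul_assoc p p, mul_comm p (p * (p * c)), pow_mul, hξ.pow_eq_one, one_pow])
    rw [← hi]
    exact pow_mem (IntermediateField.mem_adjoin_simple_self ℚ ζ) i

end RootsOfUnity

/-- For a positive integer `n`: `n` is not square-free if and only if
there exists a subfield `F` of `ℂ` (with the subspace topology) such that `STP(n,F)` is
minimal but not z-minimal. -/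
theorem not_squarefree_iff_exists_stp_minimal_not_zMinimal
    (n : ℕ) (hn : 0 < n) :
    ¬ Squarefree n ↔
      ∃ F : Subfield ℂ, IsMinimal ↥(STP n ↥F) ∧ ¬ IsZMinimal ↥(STP n ↥F) := by
  constructor
  · intro h
    obtain ⟨p, hp, hpn⟩ : ∃ p, p.Prime ∧ p * p ∣ n := by
      simpa [Nat.squarefree_iff_prime_squarefree] using h
    obtain ⟨k, rfl⟩ : ∃ k, n = k + 2 :=
      Nat.exists_eq_add_of_le' (by nlinarith [hp.two_le, Nat.le_of_dvd hn hpn])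
    set M := UniqueFactorizationMonoid.radical (3 * (k + 2))
    have hM : Squarefree M := UniqueFactorizationMonoid.squarefree_radical
    have hdvd : ∀ q, q.Prime → q ∣ 3 * (k + 2) → q ∣ M := fun q hq hqn =>
      (UniqueFactorizationMonoid.dvd_radical_iff_of_irreducible hq (by omega)).2 hqn
    have hζ := Complex.isPrimitiveRoot_exp M hM.ne_zero
    set ζ := Complex.exp (2 * Real.pi * Complex.I / M)
    have : NeZero M := ⟨hM.ne_zero⟩
    have hmem : ∀ q, q.Prime → q ∣ 3 * (k + 2) → ∀ x : ℂ, x ^ q = 1 →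
        x ∈ (IntermediateField.adjoin ℚ {ζ}).toSubfield := by
      intro q hq hqn x hx
      obtain ⟨c, hc⟩ := hdvd q hq hqn
      obtain ⟨i, -, hi⟩ := hζ.eq_pow_of_pow_eq_one (ξ := x) (by rw [hc, pow_mul, hx, one_pow])
      rw [← hi]
      exact pow_mem (IntermediateField.mem_adjoin_simple_self ℚ ζ) i
    refine ⟨_, STP.isMinimal fun q hq hqk x _ hx => hmem q hq (hqk.mul_left 3) x hx, fun hz => ?_⟩
    obtain ⟨x, hx, hxF⟩ := exists_pow_prime_sq_eq_one_notMem_adjoin hM hp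
      (hdvd p hp ((Dvd.intro _ rfl).trans (hpn.mul_left 3))) hζ
    refine hxF (STP.mem_of_isMinimal_quotient_center hz.2 ?_ ?_)
    · have hω := Complex.isPrimitiveRoot_exp 3 (by norm_num)
      rw [closure_eq_univ_of_isPrimitiveRoot_three hω
        (hmem 3 Nat.prime_three (dvd_mul_right _ _) _ hω.pow_eq_one)]
      exact Set.mem_univ x
    · obtain ⟨c, hc⟩ := hpn
      rw [hc, pow_mul, hx, one_pow]
  · rintro ⟨F, hmin, hz⟩ hsq
    refine hz ⟨hmin, ?_⟩
    obtain _ | _ | k := n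
    · omega
    · have : Subsingleton (STP 1 F) := by
        refine ⟨fun g h => STP.mat_injective (Matrix.ext fun i j => ?_)⟩
        have hone : ∀ x : STP 1 F, STP.mat x 0 0 = 1 := fun x => by
          simpa using STP.prod_mat_diag x
        rw [Subsingleton.elim i 0, Subsingleton.elim j 0, hone, hone]
      exact isMinimal_of_subsingleton
    · exact STP.isMinimal_quotient_center fun ζ hζF hζ =>
        mem_subfield_of_pow_eq_one_of_squarefree hsq
          (fun p hp hpk ξ hξF hξ => STP.mem_of_isMinimal hmin hp hpk hξF hξ) hζF hζ
end

section
/- Let 𝒫 be the set of all prime numbers and, for each p ∈ 𝒫, let (ℚ, τ_p) denote the field of rational numbers equipped with the p-adic topology (the topology induced by the p-adic norm). Then the topological product H = ∏_{p ∈ 𝒫} STP(p+1, (ℚ, τ_p)) is minimal. -/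
/-- `QPadic p hp` is the field `ℚ` of rational numbers equipped with the `p`-adic topology,
i.e. the topology induced by the `p`-adic norm (equivalently, induced by the inclusion
`ℚ → ℚ_[p]`). -/
def QPadic (p : ℕ) (hp : p.Prime) : Type := ℚ

instance (p : ℕ) (hp : p.Prime) : Field (QPadic p hp) := inferInstanceAs (Field ℚ)

noncomputable instance (p : ℕ) (hp : p.Prime) : TopologicalSpace (QPadic p hp) :=
  haveI : Fact p.Prime := ⟨hp⟩
  TopologicalSpace.induced (fun q : ℚ => (q : ℚ_[p])) inferInstance

open Filter Topology

instance Matrix.SpecialLinearGroup.isTopologicalGroup_of_isTopologicalRing {m : Type*}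
    [DecidableEq m] [Fintype m] {R : Type*} [CommRing R] [TopologicalSpace R]
    [IsTopologicalRing R] : IsTopologicalGroup (Matrix.SpecialLinearGroup m R) where
  continuous_mul := by
    have h : Continuous fun A : Matrix.SpecialLinearGroup m R => (A : Matrix m m R) :=
      continuous_subtype_val
    refine continuous_induced_rng.2 ?_
    exact (h.comp continuous_fst).matrix_mul (h.comp continuous_snd)
  continuous_inv := by
    have h : Continuous fun A : Matrix.SpecialLinearGroup m R => (A : Matrix m m R) :=
      continuous_subtype_val
    refine continuous_induced_rng.2 ?_
    exact h.matrix_adjugate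

theorem isClosed_singleton_of_hasBasis {F : Type*} [Field F] [TopologicalSpace F]
    [IsTopologicalRing F] (v : AbsoluteValue F ℝ)
    (hv : (𝓝 (0 : F)).HasBasis (fun ε : ℝ => 0 < ε) (fun ε => {x | v x < ε})) (a : F) :
    IsClosed ({a} : Set F) := by
  have : T2Space F := IsTopologicalAddGroup.t2Space_of_zero_sep fun x hx =>
    ⟨_, hv.mem_of_mem (v.pos hx), by simp⟩
  exact isClosed_singleton

/-- A Hausdorff group topology on the additive group of a valued field for which multiplication
by units is jointly continuous near `(1, 0)` is at least as fine as the valuation topology. -/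
theorem tendsto_zero_of_tendsto_one_of_units_conj {F : Type*} [Field F] [TopologicalSpace F]
    [IsTopologicalDivisionRing F] (v : AbsoluteValue F ℝ)
    (hv : (𝓝 (0 : F)).HasBasis (fun ε : ℝ => 0 < ε) (fun ε => {x | v x < ε}))
    (hc : ∃ c, 1 < v c) {H : Type*} [Group H] [TopologicalSpace H] [IsTopologicalGroup H]
    [T2Space H] (φ : F → H) (τ : Fˣ → H) (hadd : ∀ x y, φ (x + y) = φ x * φ y) (hφ : φ 1 ≠ 1)
    (hτ : Tendsto τ (𝓝 1) (𝓝 1)) (hτφ : ∀ c x, τ c * φ x * (τ c)⁻¹ = φ (c * x))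
    {α : Type*} {l : Filter α} {u : α → F} (hu : Tendsto (fun a => φ (u a)) l (𝓝 1)) :
    Tendsto u l (𝓝 0) := by
  have key : Tendsto (fun q : Fˣ × H => τ q.1 * q.2 * (τ q.1)⁻¹ * q.2⁻¹) (𝓝 1 ×ˢ 𝓝 1) (𝓝 1) := by
    have h1 : Tendsto (fun q : Fˣ × H => τ q.1) (𝓝 1 ×ˢ 𝓝 1) (𝓝 1) := hτ.comp tendsto_fst
    have h2 : Tendsto (fun q : Fˣ × H => q.2) (𝓝 1 ×ˢ 𝓝 1) (𝓝 1) := tendsto_snd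
    simpa using ((h1.mul h2).mul h1.inv).mul h2.inv
  have hne : ∀ᶠ h in 𝓝 (1 : H), h ≠ φ 1 := isOpen_ne.mem_nhds hφ.symm
  obtain ⟨P, hP, Q, hQ, hPQ⟩ := eventually_prod_iff.1 (key.eventually hne)
  rw [Filter.Eventually, Units.isEmbedding_val₀.isInducing.nhds_eq_comap, Units.val_one] at hP
  obtain ⟨t, ht, htP⟩ := mem_comap.1 hP
  have hadd1 : Tendsto (fun x : F => 1 + x) (𝓝 0) (𝓝 1) := by
    simpa using (tendsto_const_nhds (x := (1 : F))).add (tendsto_id (x := 𝓝 (0 : F)))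
  have hcl : IsOpen ({0}ᶜ : Set F) := by
    rw [isOpen_compl_iff]
    exact isClosed_singleton_of_hasBasis v hv 0
  have h0 : ∀ᶠ x in 𝓝 (0 : F), 1 + x ∈ t ∧ 1 + x ≠ 0 :=
    hadd1.eventually ((show ∀ᶠ x in 𝓝 (1 : F), x ∈ t from ht).and (hcl.mem_nhds one_ne_zero))
  obtain ⟨ε, hε, hball⟩ := hv.eventually_iff.1 h0
  have bound : ∀ w, Q (φ w) → v w ≤ 1 / ε := by
    intro w hw
    by_contra! hlt
    have hvw : 0 < v w := lt_trans (by positivity) hlt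
    have hw0 : w ≠ 0 := v.pos_iff.1 hvw
    have hmem : v w⁻¹ < ε := by
      rw [map_inv₀]
      exact inv_lt_of_inv_lt₀ hε (by simpa using hlt)
    obtain ⟨hwt, hne0⟩ := hball hmem
    refine @hPQ ( Units.mk0 _ hne0) (htP hwt) _ hw ?_
    have : (1 + w⁻¹) * w = 1 + w := by field_simp; ring
    simp only [hτφ, Units.val_mk0, this, hadd, mul_inv_cancel_right]
  obtain ⟨c, hc⟩ := hc
  have hc0 : c ≠ 0 := v.pos_iff.1 (zero_lt_one.trans hc)
  refine hv.tendsto_right_iff.2 fun δ hδ => ?_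
  obtain ⟨N, hN⟩ := pow_unbounded_of_one_lt (1 / ε / δ) hc
  have hconj : Tendsto (fun a => φ (c ^ N * u a)) l (𝓝 1) := by
    have := (tendsto_const_nhds (x := τ (Units.mk0 c hc0 ^ N))).mul hu |>.mul
      (tendsto_const_nhds (x := (τ (Units.mk0 c hc0 ^ N))⁻¹))
    simpa [hτφ] using this
  filter_upwards [hconj.eventually hQ] with a ha
  have h1 := bound _ ha
  rw [map_mul, map_pow] at h1
  have hpos : 0 < v c ^ N := pow_pos (zero_lt_one.trans hc) N
  rw [div_lt_iff₀ hδ] at hN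
  exact lt_of_mul_lt_mul_left (h1.trans_lt hN) hpos.le

namespace STP

/-- The matrix with top row `(d, w)`, lower right block `B`, and zeros below `d`. -/
def borderMatrix {F : Type*} [Zero F] {m : ℕ} (d : F) (w : Fin m → F)
    (B : Matrix (Fin m) (Fin m) F) : Matrix (Fin (m + 1)) (Fin (m + 1)) F :=
  Matrix.of (Fin.cons (Fin.cons d w) fun i => Fin.cons 0 (B i))

section Algebra

variable {F : Type*} [Field F] {m : ℕ}

theorem borderMatrix_mul (d d' : F) (w w' : Fin m → F) (B B' : Matrix (Fin m) (Fin m) F) :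
    borderMatrix d w B * borderMatrix d' w' B' =
      borderMatrix (d * d') (d • w' + Matrix.vecMul w B') (B * B') := by
  ext a b
  refine Fin.cases ?_ (fun a => ?_) a <;> refine Fin.cases ?_ (fun b => ?_) b <;>
    simp [borderMatrix, Matrix.mul_apply, Fin.sum_univ_succ, Matrix.vecMul, dotProduct]

theorem borderMatrix_one : borderMatrix (1 : F) 0 (1 : Matrix (Fin m) (Fin m) F) = 1 := by
  ext a b
  refine Fin.cases ?_ (fun a => ?_) a <;> refine Fin.cases ?_ (fun b => ?_) b <;>
    simp [borderMatrix, Matrix.one_apply, Fin.succ_ne_zero, (Fin.succ_ne_zero _).symm]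

theorem det_borderMatrix (d : F) (w : Fin m → F) (B : Matrix (Fin m) (Fin m) F) :
    (borderMatrix d w B).det = d * B.det := by
  rw [Matrix.det_succ_column_zero, Fin.sum_univ_succ]
  simp [borderMatrix]
  left
  rfl

theorem borderMatrix_blockTriangular (d : F) (w : Fin m → F) {B : Matrix (Fin m) (Fin m) F}
    (hB : B.BlockTriangular id) : (borderMatrix d w B).BlockTriangular id := by
  intro a b
  refine Fin.cases ?_ (fun a => ?_) a <;> refine Fin.cases ?_ (fun b => ?_) b
  · simp
  · simp
  · simp [borderMatrix]
  · intro h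
    simpa [borderMatrix] using hB (by simpa using h)

/-- The underlying matrix of an element of `STP n F`. -/
def toMatrix {n : ℕ} (g : STP n F) : Matrix (Fin n) (Fin n) F :=
  (g : Matrix.SpecialLinearGroup (Fin n) F)

theorem toMatrix_injective {n : ℕ} : Function.Injective (toMatrix : STP n F → _) :=
  fun _ _ h => Subtype.ext (Subtype.ext h)

theorem toMatrix_mul {n : ℕ} (g h : STP n F) : toMatrix (g * h) = toMatrix g * toMatrix h := rfl

theorem toMatrix_one {n : ℕ} : toMatrix (1 : STP n F) = 1 := rfl

/-- The element of `STP (m + 1) F` with top row `(d, w)` and lower right block `B`. -/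
def border (d : F) (w : Fin m → F) (B : Matrix (Fin m) (Fin m) F) (hB : B.BlockTriangular id)
    (h : d * B.det = 1) : STP (m + 1) F :=
  ⟨⟨borderMatrix d w B, by rw [det_borderMatrix, h]⟩, borderMatrix_blockTriangular d w hB⟩

theorem toMatrix_border (d : F) (w : Fin m → F) (B : Matrix (Fin m) (Fin m) F)
    (hB : B.BlockTriangular id) (h : d * B.det = 1) :
    toMatrix (border d w B hB h) = borderMatrix d w B := rfl

theorem exists_eq_border (g : STP (m + 1) F) : ∃ d w B hB h, g = border d w B hB h := by
  have hg : (toMatrix g).BlockTriangular id := g.2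
  have hdet : (toMatrix g).det = 1 := g.1.2
  have heq : toMatrix g = borderMatrix (toMatrix g 0 0) (fun b => toMatrix g 0 b.succ)
      ((toMatrix g).submatrix Fin.succ Fin.succ) := by
    ext a b
    refine Fin.cases ?_ (fun a => ?_) a <;> refine Fin.cases ?_ (fun b => ?_) b
    · rfl
    · rfl
    · exact hg (Fin.succ_pos a)
    · rfl
  refine ⟨toMatrix g 0 0, fun b => toMatrix g 0 b.succ,
    (toMatrix g).submatrix Fin.succ Fin.succ, ?_, ?_, toMatrix_injective heq⟩
  · intro a b hab
    exact hg (Fin.succ_lt_succ_iff.2 hab)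
  · rw [← det_borderMatrix, ← heq, hdet]

theorem smul_one_blockTriangular (c : F) :
    (c • (1 : Matrix (Fin m) (Fin m) F)).BlockTriangular id := by
  rw [Matrix.smul_one_eq_diagonal]
  exact Matrix.blockTriangular_diagonal _

/-- The element of the first-row subgroup with off-diagonal part `w`. -/
def row (w : Fin m → F) : STP (m + 1) F :=
  border 1 w 1 Matrix.blockTriangular_one (by simp)

theorem row_add (w w' : Fin m → F) : row (w + w') = row w * row w' := by
  refine toMatrix_injective ?_
  simp [row, toMatrix_mul, toMatrix_border, borderMatrix_mul, add_comm]

theorem row_zero : row (0 : Fin m → F) = 1 := toMatrix_injective borderMatrix_one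

theorem row_neg (w : Fin m → F) : row (-w) = (row w)⁻¹ := by
  rw [eq_inv_iff_mul_eq_one, ← row_add, neg_add_cancel, row_zero]

theorem row_injective : Function.Injective (row : (Fin m → F) → STP (m + 1) F) := by
  intro w w' h
  ext k
  exact congrFun (congrFun (congrArg toMatrix h) 0) k.succ

theorem border_inv_mul_row_mul_border (x w : Fin m → F) (d : F) (B : Matrix (Fin m) (Fin m) F)
    (hB : B.BlockTriangular id) (h : d * B.det = 1) :
    (border d x B hB h)⁻¹ * row w * border d x B hB h = row (d⁻¹ • Matrix.vecMul w B) := by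
  have hd : d ≠ 0 := left_ne_zero_of_mul_eq_one h
  rw [mul_assoc, inv_mul_eq_iff_eq_mul]
  refine toMatrix_injective ?_
  simp [row, toMatrix_mul, toMatrix_border, borderMatrix_mul, smul_smul, hd, add_comm]

end Algebra

section Topology

variable {F : Type*} [Field F] [TopologicalSpace F] {m : ℕ}

theorem isInducing_toMatrix {n : ℕ} : IsInducing (toMatrix : STP n F → _) :=
  IsInducing.subtypeVal.comp IsInducing.subtypeVal

theorem tendsto_border_iff {α : Type*} {l : Filter α} {d : α → F} {w : α → Fin m → F}
    {B : α → Matrix (Fin m) (Fin m) F} {hB : ∀ a, (B a).BlockTriangular id}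
    {h : ∀ a, d a * (B a).det = 1} {d₀ : F} {w₀ : Fin m → F} {B₀ : Matrix (Fin m) (Fin m) F}
    {hB₀ : B₀.BlockTriangular id} {h₀ : d₀ * B₀.det = 1} :
    Tendsto (fun a => border (d a) (w a) (B a) (hB a) (h a)) l (𝓝 (border d₀ w₀ B₀ hB₀ h₀)) ↔
      Tendsto d l (𝓝 d₀) ∧ Tendsto w l (𝓝 w₀) ∧ Tendsto B l (𝓝 B₀) := by
  rw [isInducing_toMatrix.tendsto_nhds_iff]
  simp only [Function.comp_def, toMatrix_border]
  constructor
  · intro H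
    have H' : ∀ i j, Tendsto (fun a => borderMatrix (d a) (w a) (B a) i j) l
        (𝓝 (borderMatrix d₀ w₀ B₀ i j)) := fun i j => tendsto_pi_nhds.1 (tendsto_pi_nhds.1 H i) j
    exact ⟨H' 0 0, tendsto_pi_nhds.2 fun j => H' 0 j.succ,
      tendsto_pi_nhds.2 fun i => tendsto_pi_nhds.2 fun j => H' i.succ j.succ⟩
  · rintro ⟨hd, hw, hB⟩
    refine tendsto_pi_nhds.2 fun i => tendsto_pi_nhds.2 fun j => ?_
    refine Fin.cases ?_ (fun i => ?_) i <;> refine Fin.cases ?_ (fun j => ?_) j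
    · exact hd
    · exact tendsto_pi_nhds.1 hw j
    · exact tendsto_const_nhds
    · exact tendsto_pi_nhds.1 (tendsto_pi_nhds.1 hB i) j

theorem tendsto_row {α : Type*} {l : Filter α} {w : α → Fin m → F} {w₀ : Fin m → F}
    (h : Tendsto w l (𝓝 w₀)) : Tendsto (fun a => row (w a)) l (𝓝 (row w₀)) :=
  tendsto_border_iff.2 ⟨tendsto_const_nhds, h, tendsto_const_nhds⟩

variable [IsTopologicalDivisionRing F] {H : Type*} [Group H] [TopologicalSpace H]
  [IsTopologicalGroup H] [T2Space H]

/-- The diagonal matrix whose `0`-th entry is `c`, whose `i.succ`-th entry is `c⁻¹`, and whose other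
diagonal entries are `1`. -/
def coroot (i : Fin m) (c : Fˣ) : STP (m + 1) F :=
  border c 0 (Matrix.diagonal (Function.update 1 i (c⁻¹ : Fˣ)))
    (Matrix.blockTriangular_diagonal _) (by
      rw [Matrix.det_diagonal, Finset.prod_update_of_mem (Finset.mem_univ i)]
      simp)

theorem tendsto_of_tendsto_row_single {i j : Fin m} (hij : i < j) (v : AbsoluteValue F ℝ)
    (hv : (𝓝 (0 : F)).HasBasis (fun ε : ℝ => 0 < ε) (fun ε => {x | v x < ε}))
    (hc : ∃ c, 1 < v c) {ι : STP (m + 1) F →* H} (hι : Continuous ι)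
    (hinj : Function.Injective ι) {α : Type*} {l : Filter α} {u : α → F}
    (hu : Tendsto (fun a => ι (row (Pi.single j (u a)))) l (𝓝 1)) : Tendsto u l (𝓝 0) := by
  have hcoroot : coroot i (1 : Fˣ) = (1 : STP (m + 1) F) := by
    refine toMatrix_injective ?_
    simp [coroot, toMatrix_border, toMatrix_one, borderMatrix_one]
  refine tendsto_zero_of_tendsto_one_of_units_conj v hv hc
    (fun x => ι (row (Pi.single j x))) (fun c => ι (coroot i c)) ?_ ?_ ?_ ?_ hu
  · intro x y
    rw [Pi.single_add, row_add, map_mul]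
  · rw [← map_one ι, ← row_zero]
    intro h
    simpa using congrFun (row_injective (hinj h)) j
  · have : Tendsto (coroot i : Fˣ → STP (m + 1) F) (𝓝 1) (𝓝 (coroot i 1)) := by
      refine tendsto_border_iff.2 ⟨Units.continuous_val.tendsto 1, tendsto_const_nhds, ?_⟩
      refine Continuous.tendsto (f := fun c : Fˣ =>
        Matrix.diagonal (Function.update (1 : Fin m → F) i (c⁻¹ : Fˣ))) ?_ 1
      exact (continuous_const.update i (Units.continuous_val.comp continuous_inv)).matrix_diagonal
    rw [hcoroot] at this
    simpa [Function.comp_def] using (hι.tendsto 1).comp this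
  · intro c x
    simp only [← map_inv, ← map_mul]
    congr 1
    rw [mul_inv_eq_iff_eq_mul]
    refine toMatrix_injective ?_
    simp only [coroot, row, toMatrix_mul, toMatrix_border, borderMatrix_mul]
    congr 1
    · simp
    · ext k
      rcases eq_or_ne k j with rfl | hk
      · simp [Function.update_of_ne hij.ne']
      · simp [hk]
    · simp

theorem tendsto_of_tendsto_row {i j : Fin m} (hij : i < j) (hj : ∀ k, k ≤ j)
    (v : AbsoluteValue F ℝ)
    (hv : (𝓝 (0 : F)).HasBasis (fun ε : ℝ => 0 < ε) (fun ε => {x | v x < ε}))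
    (hc : ∃ c, 1 < v c) {ι : STP (m + 1) F →* H} (hι : Continuous ι)
    (hinj : Function.Injective ι) {α : Type*} {l : Filter α} {u : α → Fin m → F}
    (hu : Tendsto (fun a => ι (row (u a))) l (𝓝 1)) : Tendsto u l (𝓝 0) := by
  have hlt : ∀ k, k ≠ j → Tendsto (fun a => u a k) l (𝓝 0) := by
    intro k hk
    refine tendsto_of_tendsto_row_single hij v hv hc hι hinj ?_
    have hdet : (1 : F) * (Matrix.transvection k j (1 : F)).det = 1 := by
      rw [Matrix.det_transvection_of_ne _ _ hk, one_mul]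
    set s : STP (m + 1) F := border 1 0 (Matrix.transvection k j 1)
      (Matrix.blockTriangular_transvection (hj k) 1) hdet with hs
    have heq : ∀ w : Fin m → F, row (Pi.single j (w k)) = (row w)⁻¹ * (s⁻¹ * row w * s) := by
      intro w
      rw [hs, border_inv_mul_row_mul_border, eq_inv_mul_iff_mul_eq, ← row_add]
      congr 1
      simp only [inv_one, one_smul, Matrix.transvection, Matrix.vecMul_add, Matrix.vecMul_one]
      congr 1
      ext b
      rcases eq_or_ne b j with rfl | hb
      · simp [Matrix.vecMul, dotProduct, Matrix.single_apply]
      · simp [Matrix.vecMul, dotProduct, hb, hb.symm]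
    simp only [heq, map_mul, map_inv]
    simpa using hu.inv.mul (((tendsto_const_nhds (x := (ι s)⁻¹)).mul hu).mul
      (tendsto_const_nhds (x := ι s)))
  refine tendsto_pi_nhds.2 fun k => ?_
  rcases ne_or_eq k j with hk | rfl
  · exact hlt k hk
  refine tendsto_of_tendsto_row_single hij v hv hc hι hinj ?_
  have h0 : Tendsto (fun a => Function.update (u a) k 0) l (𝓝 0) := by
    refine tendsto_pi_nhds.2 fun b => ?_
    rcases ne_or_eq b k with hb | rfl
    · simpa [hb] using hlt b hb
    · simpa using tendsto_const_nhds
  have h1 := (hι.tendsto _).comp (tendsto_row h0)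
  rw [row_zero, map_one] at h1
  have heq : ∀ w : Fin m → F, row (Pi.single k (w k)) = (row (Function.update w k 0))⁻¹ * row w := by
    intro w
    rw [eq_inv_mul_iff_mul_eq, ← row_add]
    congr 1
    ext b
    rcases ne_or_eq b k with hb | rfl
    · simp [hb]
    · simp
  simp only [heq, map_mul, map_inv]
  simpa using h1.inv.mul hu

theorem exists_tendsto_of_conj {i j : Fin m} (hij : i < j) (hj : ∀ k, k ≤ j)
    (v : AbsoluteValue F ℝ)
    (hv : (𝓝 (0 : F)).HasBasis (fun ε : ℝ => 0 < ε) (fun ε => {x | v x < ε}))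
    (hc : ∃ c, 1 < v c)
    (hroot : ∀ l : Ultrafilter F, Tendsto (fun x : F => x ^ (m + 1)) l (𝓝 1) →
      ∃ z, z ^ (m + 1) = 1 ∧ (l : Filter F) ≤ 𝓝 z)
    {ι : STP (m + 1) F →* H} (hι : Continuous ι) (hinj : Function.Injective ι)
    {π : H → STP (m + 1) F} (hconj : ∀ h g, h⁻¹ * ι g * h = ι ((π h)⁻¹ * g * π h))
    {l : Ultrafilter H} (hl : (l : Filter H) ≤ 𝓝 1) : ∃ z, Tendsto π l (𝓝 z) := by
  choose d w B hB hdet hπ using fun h => exists_eq_border (π h)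
  have hd : ∀ h, d h ≠ 0 := fun h => left_ne_zero_of_mul_eq_one (hdet h)
  have hlim : ∀ g, Tendsto (fun h => ι (g⁻¹ * ((π h)⁻¹ * g * π h))) l (𝓝 1) := by
    intro g
    have hid : Tendsto (fun h : H => h) l (𝓝 1) := hl
    simp only [map_mul ι g⁻¹, ← hconj]
    simpa using (tendsto_const_nhds (x := ι g⁻¹)).mul
      ((hid.inv.mul (tendsto_const_nhds (x := ι g))).mul hid)
  have hY : Tendsto (fun h => (d h)⁻¹ • B h) l (𝓝 1) := by
    refine tendsto_pi_nhds.2 fun k => ?_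
    have heq : ∀ h, (row (Pi.single k 1))⁻¹ * ((π h)⁻¹ * row (Pi.single k 1) * π h) =
        row (((d h)⁻¹ • B h) k - Pi.single k 1) := by
      intro h
      rw [hπ h, border_inv_mul_row_mul_border, inv_mul_eq_iff_eq_mul, ← row_add]
      congr 1
      ext b
      simp
    have h1 := hlim (row (Pi.single k 1))
    simp only [heq] at h1
    have h2 := (tendsto_of_tendsto_row hij hj v hv hc hι hinj h1).add
      (tendsto_const_nhds (x := (Pi.single k 1 : Fin m → F)))
    simp only [sub_add_cancel, zero_add] at h2
    convert h2 using 2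
    ext b
    simp [Matrix.one_apply, Pi.single_apply, eq_comm]
  have hpow : Tendsto (fun h => (d h)⁻¹ ^ (m + 1)) l (𝓝 1) := by
    have h1 := ((continuous_id.matrix_det).tendsto (1 : Matrix (Fin m) (Fin m) F)).comp hY
    refine (by simpa using h1 : Tendsto _ _ _).congr fun h => ?_
    have : (B h).det = (d h)⁻¹ := eq_inv_of_mul_eq_one_right (hdet h)
    simp [this, pow_succ]
  obtain ⟨z, hz1, hz⟩ := hroot (l.map fun h => (d h)⁻¹) hpow
  have hz0 : z ≠ 0 := by
    rintro rfl
    simp at hz1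
  have hd_lim : Tendsto d l (𝓝 z⁻¹) := by
    simpa using Tendsto.inv₀ (f := fun h => (d h)⁻¹) hz hz0
  have hB_lim : Tendsto B l (𝓝 (z⁻¹ • 1)) :=
    (hd_lim.smul hY).congr fun h => by rw [smul_smul, mul_inv_cancel₀ (hd h), one_smul]
  have hw_lim : Tendsto w l (𝓝 0) := by
    obtain ⟨c, hc'⟩ := hc
    have hc0 : c ≠ 0 := v.pos_iff.1 (zero_lt_one.trans hc')
    have hcm : c ^ m ≠ 0 := pow_ne_zero m hc0
    have hsub : c ^ m - c⁻¹ ≠ 0 := by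
      intro h
      have h1 : c ^ (m + 1) = 1 := by
        rw [pow_succ, sub_eq_zero.1 h, inv_mul_cancel₀ hc0]
      have h2 := one_lt_pow₀ hc' m.succ_ne_zero
      rw [← map_pow, Nat.succ_eq_add_one, h1, map_one] at h2
      exact lt_irrefl _ h2
    set t : STP (m + 1) F := border (c ^ m) 0 (c⁻¹ • 1)
      (smul_one_blockTriangular _)
      (by simp [hcm]) with ht
    have heq : ∀ h, t⁻¹ * ((π h)⁻¹ * t * π h) =
        row (((c ^ m - c⁻¹) / (d h * c ^ m)) • w h) := by
      intro h
      rw [inv_mul_eq_iff_eq_mul, mul_assoc, inv_mul_eq_iff_eq_mul, hπ h, ht]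
      refine toMatrix_injective ?_
      simp only [row, toMatrix_mul, toMatrix_border, borderMatrix_mul]
      congr 1
      · ring
      · have := hd h
        ext b
        simp [Matrix.vecMul_smul]
        field_simp
        ring
      · simp
    have h1 := hlim t
    simp only [heq] at h1
    have h2 := ((hd_lim.mul_const (c ^ m)).div_const (c ^ m - c⁻¹)).smul
      (tendsto_of_tendsto_row hij hj v hv ⟨c, hc'⟩ hι hinj h1)
    rw [smul_zero] at h2
    refine h2.congr fun h => ?_
    have := hd h
    rw [smul_smul, div_mul_div_cancel₀ hsub, div_self (mul_ne_zero (hd h) hcm), one_smul]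
  refine ⟨border z⁻¹ 0 (z⁻¹ • 1)
    (smul_one_blockTriangular _)
    (by rw [Matrix.det_smul, Matrix.det_one, mul_one, Fintype.card_fin, ← pow_succ', inv_pow, hz1,
      inv_one]), ?_⟩
  rw [funext hπ]
  exact tendsto_border_iff.2 ⟨hd_lim, hw_lim, hB_lim⟩

end Topology

end STP

theorem PadicInt.norm_sub_one_eq_of_toZMod_eq_one {p : ℕ} [Fact p.Prime] {x : ℤ_[p]}
    (hx : PadicInt.toZMod x = 1) : ‖x - 1‖ = ‖x ^ (p + 1) - 1‖ := by
  have hs : ‖∑ i ∈ Finset.range (p + 1), x ^ i‖ = 1 := by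
    rw [← PadicInt.isUnit_iff, ← not_not (a := IsUnit _), ← mem_nonunits_iff,
      ← IsLocalRing.mem_maximalIdeal, ← PadicInt.ker_toZMod, RingHom.mem_ker]
    simp [hx]
  rw [← mul_geom_sum, norm_mul, hs, mul_one]

theorem PadicInt.norm_sub_one_or_norm_add_one_eq {p : ℕ} [hp : Fact p.Prime] {x : ℤ_[p]}
    (hx : ‖x ^ (p + 1) - 1‖ < 1) :
    ‖x - 1‖ = ‖x ^ (p + 1) - 1‖ ∨ (Odd p ∧ ‖x + 1‖ = ‖x ^ (p + 1) - 1‖) := by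
  have h1 : PadicInt.toZMod (x ^ (p + 1) - 1) = 0 := by
    rw [← RingHom.mem_ker, PadicInt.ker_toZMod, IsLocalRing.mem_maximalIdeal, PadicInt.mem_nonunits]
    exact hx
  have h2 : PadicInt.toZMod x * PadicInt.toZMod x = 1 := by
    simpa [pow_succ, ZMod.pow_card, sub_eq_zero] using h1
  rcases mul_self_eq_one_iff.1 h2 with h | h
  · exact Or.inl (norm_sub_one_eq_of_toZMod_eq_one h)
  · rcases hp.out.eq_two_or_odd' with rfl | hodd
    · refine Or.inl (norm_sub_one_eq_of_toZMod_eq_one (h.trans ?_))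
      exact CharTwo.neg_eq 1
    · refine Or.inr ⟨hodd, ?_⟩
      have := norm_sub_one_eq_of_toZMod_eq_one (x := -x) (by simp [h])
      rw [(hodd.add_one).neg_pow] at this
      rw [← this, ← norm_neg]
      ring_nf

namespace QPadic

variable (p : ℕ) (hp : p.Prime)

/-- The inclusion of `ℚ` with its `p`-adic topology into `ℚ_[p]`. -/
noncomputable def toPadic [Fact p.Prime] : QPadic p hp →+* ℚ_[p] := Rat.castHom ℚ_[p]

theorem isInducing_toPadic [Fact p.Prime] : IsInducing (toPadic p hp) := ⟨rfl⟩

instance : IsTopologicalDivisionRing (QPadic p hp) :=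
  have : Fact p.Prime := ⟨hp⟩
  have hi := isInducing_toPadic p hp
  { continuous_add := by
      rw [hi.continuous_iff]
      simp only [Function.comp_def, map_add]
      exact (hi.continuous.comp continuous_fst).add (hi.continuous.comp continuous_snd)
    continuous_mul := by
      rw [hi.continuous_iff]
      simp only [Function.comp_def, map_mul]
      exact (hi.continuous.comp continuous_fst).mul (hi.continuous.comp continuous_snd)
    continuous_neg := by
      rw [hi.continuous_iff]
      simp only [Function.comp_def, map_neg]
      exact hi.continuous.neg
    continuousAt_inv₀ := fun x hx => by
      rw [hi.continuousAt_iff]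
      simp only [Function.comp_def, map_inv₀]
      exact hi.continuous.continuousAt.inv₀ ((map_ne_zero _).2 hx) }

/-- The `p`-adic absolute value. -/
noncomputable def abv [Fact p.Prime] : AbsoluteValue (QPadic p hp) ℝ :=
  (NormedField.toAbsoluteValue ℚ_[p]).comp (toPadic p hp).injective

theorem nhds_zero_hasBasis [Fact p.Prime] :
    (𝓝 (0 : QPadic p hp)).HasBasis (fun ε : ℝ => 0 < ε) (fun ε => {x | abv p hp x < ε}) := by
  rw [(isInducing_toPadic p hp).nhds_eq_comap, map_zero]
  convert Metric.nhds_basis_ball.comap (toPadic p hp) using 2 with ε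
  ext x
  simp only [Set.mem_ofPred_eq, Set.mem_preimage, mem_ball_zero_iff]
  rfl

theorem exists_one_lt_abv [Fact p.Prime] : ∃ c, 1 < abv p hp c := by
  obtain ⟨q, hq⟩ : ∃ q : ℚ, 1 < ‖(q : ℚ_[p])‖ := ⟨(p : ℚ)⁻¹, by
    simpa using hp.one_lt⟩
  exact ⟨q, hq⟩

theorem exists_le_nhds_of_tendsto_pow (l : Ultrafilter (QPadic p hp))
    (hl : Tendsto (fun x : QPadic p hp => x ^ (p + 1)) l (𝓝 1)) :
    ∃ z, z ^ (p + 1) = 1 ∧ (l : Filter (QPadic p hp)) ≤ 𝓝 z := by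
  have : Fact p.Prime := ⟨hp⟩
  have hi := isInducing_toPadic p hp
  have h1 : Tendsto (fun x => ‖toPadic p hp x ^ (p + 1) - 1‖) l (𝓝 0) := by
    have := tendsto_iff_norm_sub_tendsto_zero.1 (hi.tendsto_nhds_iff.1 hl)
    simpa using this
  have h2 : ∀ᶠ x in (l : Filter (QPadic p hp)),
      ‖toPadic p hp x - 1‖ = ‖toPadic p hp x ^ (p + 1) - 1‖ ∨
        (Odd p ∧ ‖toPadic p hp x + 1‖ = ‖toPadic p hp x ^ (p + 1) - 1‖) := by
    filter_upwards [h1.eventually (gt_mem_nhds one_pos)] with x hx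
    have hx1 : ‖toPadic p hp x‖ ≤ 1 := by
      have h3 : ‖toPadic p hp x ^ (p + 1)‖ ≤ 1 := by
        have := Padic.nonarchimedean (toPadic p hp x ^ (p + 1) - 1) 1
        rw [sub_add_cancel, norm_one] at this
        exact this.trans (max_le hx.le le_rfl)
      rw [norm_pow] at h3
      exact (pow_le_one_iff_of_nonneg (norm_nonneg _) p.succ_ne_zero).1 h3
    exact PadicInt.norm_sub_one_or_norm_add_one_eq (x := ⟨toPadic p hp x, hx1⟩) hx
  rcases Ultrafilter.eventually_or.1 h2 with h | h
  · refine ⟨1, one_pow _, hi.tendsto_nhds_iff (f := id).2 ?_⟩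
    refine tendsto_iff_norm_sub_tendsto_zero.2 (h1.congr' ?_)
    filter_upwards [h] with x hx
    simp [hx]
  · obtain ⟨hodd, h⟩ := Filter.eventually_and.1 h
    refine ⟨-1, ?_, hi.tendsto_nhds_iff (f := id).2 ?_⟩
    · obtain ⟨x, hx⟩ := hodd.exists
      exact (hx.add_one).neg_one_pow
    refine tendsto_iff_norm_sub_tendsto_zero.2 (h1.congr' ?_)
    filter_upwards [h] with x hx
    simp [hx]

end QPadic

/-- The topological product `H = ∏_{p prime} STP(p+1, (ℚ, τ_p))` is
minimal, where `(ℚ, τ_p)` is the field of rationals with the `p`-adic topology. -/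
theorem prod_stp_padic_minimal :
    IsMinimal (∀ p : {q : ℕ // q.Prime},
      ↥(STP (p.1 + 1) (QPadic p.1 p.2))) := by
  classical
  intro σ hσ hT2
  refine IsTopologicalGroup.ext σ.toIsTopologicalGroup inferInstance ?_
  refine le_antisymm ?_ (nhds_mono hσ)
  refine le_iff_ultrafilter.2 fun l hl => ?_
  have hcoord : ∀ p : {q : ℕ // q.Prime}, ∃ z, Tendsto (fun g : ∀ p : {q : ℕ // q.Prime},
      ↥(STP (p.1 + 1) (QPadic p.1 p.2)) => g p) l (𝓝 z) := by
    intro p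
    have : Fact p.1.Prime := ⟨p.2⟩
    have hp := p.2.two_le
    refine @STP.exists_tendsto_of_conj (QPadic p.1 p.2) _ _ p.1 _ _ _ σ.toTopologicalSpace
      σ.toIsTopologicalGroup hT2 ⟨0, by omega⟩ ⟨p.1 - 1, by omega⟩ (Fin.mk_lt_mk.2 (by omega))
      (fun k => Fin.le_def.2 (by have := k.2; simp only; omega)) (QPadic.abv p.1 p.2)
      (QPadic.nhds_zero_hasBasis p.1 p.2) (QPadic.exists_one_lt_abv p.1 p.2)
      (QPadic.exists_le_nhds_of_tendsto_pow p.1 p.2)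
      (MonoidHom.mulSingle (fun p : {q : ℕ // q.Prime} => ↥(STP (p.1 + 1) (QPadic p.1 p.2))) p)
      (continuous_le_rng hσ ?_) ?_ (fun g => g p) ?_ l hl
    · exact continuous_mulSingle (A := fun p : {q : ℕ // q.Prime} =>
        ↥(STP (p.1 + 1) (QPadic p.1 p.2))) p
    · exact Pi.mulSingle_injective (M := fun p : {q : ℕ // q.Prime} =>
        ↥(STP (p.1 + 1) (QPadic p.1 p.2))) p
    intro h g
    ext1 q
    rcases eq_or_ne q p with rfl | hq
    · simp
    · simp [hq]
  choose z hz using hcoord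
  have hlz : (l : Filter _) ≤ 𝓝 z := tendsto_pi_nhds.2 hz
  have hz1 : z = 1 := by
    exact @tendsto_nhds_unique _ _ σ.toTopologicalSpace hT2 id l z 1 _
      (hlz.trans (nhds_mono hσ)) hl
  exact hz1 ▸ hlz
end

section
/- Let X and Y be groups and n a positive integer. Then the subgroup X × Z_n(Y) is unconditionally closed in X × Y, i.e. for every Hausdorff group topology σ on the group X × Y, the set X × Z_n(Y) is σ-closed. -/
/-- Let `X` and `Y` be groups and `n` a positive integer. Then
`X × Z_n(Y)` (where `Z_n(Y)` is the `n`-th term of the upper central series of `Y`) is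
unconditionally closed in `X × Y`: it is closed in every Hausdorff group topology `σ` on
the group `X × Y`. -/
theorem prod_upperCentralSeries_unconditionallyClosed
    {X Y : Type*} [Group X] [Group Y] (n : ℕ) (hn : 0 < n)
    (σ : GroupTopology (X × Y)) (hσ : @T2Space (X × Y) σ.toTopologicalSpace) :
    @IsClosed (X × Y) σ.toTopologicalSpace
      ((Set.univ : Set X) ×ˢ ((upperCentralSeries Y n : Subgroup Y) : Set Y)) := by
  let := σ.toTopologicalSpace
  have := σ.toIsTopologicalGroup
  have hcont (b : Y) : Continuous fun p : X × Y => p * (1, b) * p⁻¹ * (1, b)⁻¹ :=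
    ((continuous_id.mul continuous_const).mul continuous_id.inv).mul continuous_const
  induction n, hn using Nat.le_induction with
  | base =>
    have hset : (Set.univ : Set X) ×ˢ ((upperCentralSeries Y 1 : Subgroup Y) : Set Y) =
        ⋂ b : Y, (fun p : X × Y => p * (1, b) * p⁻¹ * (1, b)⁻¹) ⁻¹' {1} := by
      ext ⟨x, y⟩
      simp [Prod.ext_iff]
      exact Subgroup.mem_upperCentralSeries_succ_iff (n := 0)
    rw [hset]
    exact isClosed_iInter fun b => isClosed_singleton.preimage (hcont b)
  | succ n _ ih =>
    have hset : (Set.univ : Set X) ×ˢ ((upperCentralSeries Y (n + 1) : Subgroup Y) : Set Y) =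
        ⋂ b : Y, (fun p : X × Y => p * (1, b) * p⁻¹ * (1, b)⁻¹) ⁻¹'
          ((Set.univ : Set X) ×ˢ ((upperCentralSeries Y n : Subgroup Y) : Set Y)) := by
      ext ⟨x, y⟩
      simp
      exact Subgroup.mem_upperCentralSeries_succ_iff
    rw [hset]
    exact isClosed_iInter fun b => ih.preimage (hcont b)
end
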